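/- arXiv:math/0601141 — 2 statements merged into one kernel-verified Lean document; each statement's English description precedes it below -/
import Mathlib

section
/- Let X be a geometrically integral smooth projective curve of genus g over a field k. If g > 1, then γ_k(X) ≤ 2g − 2. -/
open IntermediateField

/-- The gonality of the function field `F` of a curve over `k`: the smallest degree
`[F : k(f)]` of a nonconstant rational function `f ∈ F`, i.e. the smallest degree of a
dominant rational map from the curve to `ℙ¹_k`. -/
noncomputable def gonality (k F : Type*) [Field k] [Field F] [Algebra k F] : ℕ :=
  sInf {d : ℕ | ∃ f : F, Transcendental k f ∧
    Module.finrank (IntermediateField.adjoin k {f}) F = d}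

/-- `F` is the function field of a curve over `k`: a finitely generated field extension of
transcendence degree 1, i.e. a finite extension of some `k(x)` with `x` transcendental. -/
def IsFunctionField (k F : Type*) [Field k] [Field F] [Algebra k F] : Prop :=
  ∃ x : F, Transcendental k x ∧
    FiniteDimensional (IntermediateField.adjoin k {x}) F

/-- A place of the function field `F/k`: a valuation subring of `F` containing `k`
and different from `F` itself.  These correspond to the closed points of the smooth
projective model of the curve. -/
structure FFPlace (k F : Type*) [Field k] [Field F] [Algebra k F] where
  asSubring : ValuationSubring F
  algebraMap_mem : ∀ a : k, algebraMap k F a ∈ asSubring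
  ne_top : asSubring ≠ ⊤

variable (k F : Type*) [Field k] [Field F] [Algebra k F]

/-- The degree of a place: the `k`-dimension of its residue field. -/
noncomputable def FFPlace.degree (P : FFPlace k F) : ℕ :=
  letI : Algebra k (IsLocalRing.ResidueField P.asSubring) :=
    ((IsLocalRing.residue (P.asSubring : Type _)).comp
      ((algebraMap k F).codRestrict P.asSubring.toSubring P.algebraMap_mem)).toAlgebra
  Module.finrank k (IsLocalRing.ResidueField P.asSubring)

/-- The space of adeles (repartitions) of `F/k`: families `(α_P)_P` indexed by the places of
`F/k` with `α_P` integral at all but finitely many places, as a `k`-submodule of `Π_P F`. -/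
def adeleSubmodule : Submodule k (FFPlace k F → F) where
  carrier := {α | {P : FFPlace k F | α P ∉ P.asSubring}.Finite}
  zero_mem' := by
    show {P : FFPlace k F | (0 : F) ∉ P.asSubring}.Finite
    convert Set.finite_empty using 2
    ext P
    simp [zero_mem]
  add_mem' := by
    intro a b ha hb
    refine Set.Finite.subset (ha.union hb) ?_
    intro P hP
    rw [Set.mem_union]
    by_contra h
    push_neg at h
    simp only [Set.mem_setOf_eq, not_not] at h
    exact hP (add_mem h.1 h.2)
  smul_mem' := by
    intro c α hα
    refine Set.Finite.subset hα ?_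
    intro P hP
    by_contra h
    simp only [Set.mem_setOf_eq, not_not] at h
    refine hP ?_
    show c • α P ∈ P.asSubring
    rw [Algebra.smul_def]
    exact mul_mem (P.algebraMap_mem c) h

/-- The adeles that are integral at every place. -/
def integralAdeles : Submodule k (FFPlace k F → F) where
  carrier := {α | ∀ P : FFPlace k F, α P ∈ P.asSubring}
  zero_mem' := fun P => zero_mem _
  add_mem' := fun ha hb P => add_mem (ha P) (hb P)
  smul_mem' := by
    intro c α hα P
    show c • α P ∈ P.asSubring
    rw [Algebra.smul_def]
    exact mul_mem (P.algebraMap_mem c) (hα P)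

/-- The principal adeles: the diagonal image of `F`. -/
def principalAdeles : Submodule k (FFPlace k F → F) :=
  LinearMap.range (LinearMap.pi fun _ : FFPlace k F => (LinearMap.id : F →ₗ[k] F))

/-- The genus of the function field `F/k`, defined à la Chevalley/Weil as the `k`-dimension of
`A / (A(0) + F)`, where `A` is the space of adeles, `A(0)` the everywhere-integral ones and `F`
the principal ones.  For the function field of a geometrically integral smooth projective curve
this is the usual genus. -/
noncomputable def genus : ℕ :=
  Module.finrank k
    (↥(adeleSubmodule k F) ⧸
      ((integralAdeles k F ⊔ principalAdeles k F).comap (adeleSubmodule k F).subtype))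



section LinearAlgebra

variable {K U W : Type*} [Field K] [AddCommGroup U] [Module K U] [AddCommGroup W] [Module K W]

/-- Rank–nullity for the restriction of a linear map to a submodule, as an upper bound. -/
theorem Submodule.finite_and_finrank_le_of_map_le (T : U →ₗ[K] W) (N N' : Submodule K U)
    (H : Submodule K W) [FiniteDimensional K N'] [FiniteDimensional K H]
    (hH : N.map T ≤ H) (hN' : N ⊓ LinearMap.ker T ≤ N') :
    FiniteDimensional K N ∧ Module.finrank K N ≤ Module.finrank K N' + Module.finrank K H := by
  let S : N →ₗ[K] H := T.restrict fun x hx => hH (Submodule.mem_map_of_mem hx)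
  let i : LinearMap.ker S →ₗ[K] N' :=
    (N.subtype.comp (LinearMap.ker S).subtype).codRestrict N' fun x =>
      hN' ⟨x.1.2, LinearMap.mem_ker.2 (congrArg Subtype.val (LinearMap.mem_ker.1 x.2))⟩
  have hi : Function.Injective i := fun x y h => by
    have h' := congrArg Subtype.val h
    exact Subtype.ext (Subtype.ext h')
  have hker : FiniteDimensional K (LinearMap.ker S) := Module.Finite.of_injective i hi
  have hrange : FiniteDimensional K (LinearMap.range S) := inferInstance
  have hquot : FiniteDimensional K (N ⧸ LinearMap.ker S) :=
    Module.Finite.equiv S.quotKerEquivRange.symm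
  have hfin : FiniteDimensional K N := Module.Finite.of_submodule_quotient (LinearMap.ker S)
  refine ⟨hfin, ?_⟩
  rw [← LinearMap.finrank_range_add_finrank_ker S, add_comm]
  exact add_le_add (LinearMap.finrank_le_finrank_of_injective hi) (Submodule.finrank_le _)

end LinearAlgebra

section Repartition

variable {k F} {V : Type*} [CommRing V] [Algebra k V] [Algebra F V] [IsScalarTower k F V]
  (O : Subalgebra k V)

theorem algebraMap_base_smul (r : k) (y : F) :
    algebraMap F V (r • y) = r • algebraMap F V y :=
  (IsScalarTower.toAlgHom k F V).toLinearMap.map_smul r y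

/-- The `k`-space of elements of `F` whose image in `V` lies in `O + xO`. -/
def boundedBy (x : F) : Submodule k F where
  carrier := {y | ∃ a ∈ O, ∃ c ∈ O, algebraMap F V y = a + algebraMap F V x * c}
  zero_mem' := ⟨0, O.zero_mem, 0, O.zero_mem, by simp⟩
  add_mem' := by
    rintro y z ⟨a, ha, c, hc, hy⟩ ⟨a', ha', c', hc', hz⟩
    exact ⟨a + a', O.add_mem ha ha', c + c', O.add_mem hc hc', by rw [map_add, hy, hz]; ring⟩
  smul_mem' := by
    rintro r y ⟨a, ha, c, hc, hy⟩
    exact ⟨r • a, O.smul_mem ha r, r • c, O.smul_mem hc r, by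
      rw [algebraMap_base_smul, hy, smul_add, mul_smul_comm]⟩

/-- The image of `O + xO` in `V / O`. -/
noncomputable def polarParts (x : F) : Submodule k (V ⧸ Subalgebra.toSubmodule O) :=
  (Subalgebra.toSubmodule O).map
    ((Subalgebra.toSubmodule O).mkQ ∘ₗ LinearMap.mulLeft k (algebraMap F V x))

/-- The principal elements of `V`. -/
noncomputable def principal (k F V : Type*) [Field k] [Field F] [CommRing V] [Algebra k F]
    [Algebra k V] [Algebra F V] [IsScalarTower k F V] : Submodule k V :=
  LinearMap.range (IsScalarTower.toAlgHom k F V).toLinearMap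

omit [Algebra k F] [IsScalarTower k F V] in
theorem mem_polarParts {x : F} {q : V ⧸ Subalgebra.toSubmodule O} : q ∈ polarParts O x ↔
    ∃ b ∈ O, (Subalgebra.toSubmodule O).mkQ (algebraMap F V x * b) = q := Iff.rfl

/-- The projection `V / O → V / (O + F)`. -/
noncomputable def modPrincipal (F : Type*) [Field F] [Algebra k F] [Algebra F V]
    [IsScalarTower k F V] : (V ⧸ Subalgebra.toSubmodule O) →ₗ[k]
    (V ⧸ (Subalgebra.toSubmodule O ⊔ principal k F V)) :=
  Submodule.factor le_sup_left

theorem polarParts_inf_ker_le (x : F) :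
    polarParts O x ⊓ LinearMap.ker (modPrincipal O F) ≤
      (boundedBy O x).map ((Subalgebra.toSubmodule O).mkQ ∘ₗ
        (IsScalarTower.toAlgHom k F V).toLinearMap) := by
  rintro q ⟨hq, hker⟩
  obtain ⟨b, hb, rfl⟩ := (mem_polarParts O).1 hq
  replace hker : modPrincipal O F ((Subalgebra.toSubmodule O).mkQ (algebraMap F V x * b)) = 0 :=
    hker
  rw [modPrincipal, Submodule.factor_mk, Submodule.mkQ_apply,
    Submodule.Quotient.mk_eq_zero] at hker
  obtain ⟨a, ha, _, ⟨y, rfl⟩, hy⟩ := Submodule.mem_sup.1 hker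
  have hy' : a + algebraMap F V y = algebraMap F V x * b := hy
  refine ⟨y, ⟨-a, O.neg_mem ha, b, hb, by rw [← hy']; ring⟩, ?_⟩
  simp only [LinearMap.comp_apply, Submodule.mkQ_apply]
  rw [Submodule.Quotient.eq, ← hy]
  simpa using O.neg_mem ha

theorem finrank_polarParts_le {x : F} [FiniteDimensional k (boundedBy O x)]
    [FiniteDimensional k (V ⧸ (Subalgebra.toSubmodule O ⊔ principal k F V))] :
    FiniteDimensional k (polarParts O x) ∧ Module.finrank k (polarParts O x) ≤
      Module.finrank k (boundedBy O x) +
      Module.finrank k (V ⧸ (Subalgebra.toSubmodule O ⊔ principal k F V)) := by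
  obtain ⟨h₁, h₂⟩ := Submodule.finite_and_finrank_le_of_map_le (modPrincipal O F)
    (polarParts O x) _ ⊤ le_top (polarParts_inf_ker_le O x)
  refine ⟨h₁, h₂.trans ?_⟩
  rw [finrank_top]
  gcongr
  exact Submodule.finrank_map_le _ _

/-- The multiples of a functional on `V` by elements of `F`. -/
def functionalSMul (ω : Module.Dual k V) : F →ₗ[k] Module.Dual k V where
  toFun y := ω ∘ₗ LinearMap.mulLeft k (algebraMap F V y)
  map_add' y z := by ext v; simp [add_mul]
  map_smul' r y := by ext v; simp [algebraMap_base_smul]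

@[simp]
theorem functionalSMul_apply (ω : Module.Dual k V) (y : F) (v : V) :
    functionalSMul ω y v = ω (algebraMap F V y * v) := rfl

/-- The elements `b` of `O` with `xb ∈ O`, as a subspace of `V`. -/
def integralMultiplier (x : F) : Submodule k V :=
  Subalgebra.toSubmodule O ⊓
    (Subalgebra.toSubmodule O).comap (LinearMap.mulLeft k (algebraMap F V x))

theorem finrank_dualAnnihilator_integralMultiplier_le {x : F}
    [FiniteDimensional k (polarParts O x)]
    [FiniteDimensional k (V ⧸ (Subalgebra.toSubmodule O ⊔ principal k F V))] :
    FiniteDimensional k (integralMultiplier O x ⊔ principal k F V).dualAnnihilator ∧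
    Module.finrank k (integralMultiplier O x ⊔ principal k F V).dualAnnihilator ≤
      Module.finrank k (V ⧸ (Subalgebra.toSubmodule O ⊔ principal k F V)) +
      Module.finrank k (polarParts O x) := by
  let S := Subalgebra.toSubmodule O
  let μ : S →ₗ[k] (V ⧸ S) := (S.mkQ ∘ₗ LinearMap.mulLeft k (algebraMap F V x)).domRestrict S
  have hμ : LinearMap.range μ = polarParts O x := LinearMap.range_domRestrict _ _
  let e₁ : (S ⧸ LinearMap.ker μ) ≃ₗ[k] polarParts O x :=
    μ.quotKerEquivRange.trans (LinearEquiv.ofEq _ _ hμ)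
  have : FiniteDimensional k (S ⧸ LinearMap.ker μ) := Module.Finite.equiv e₁.symm
  let e₂ := (LinearMap.ker μ).dualQuotEquivDualAnnihilator
  let e₃ := (S ⊔ principal k F V).dualQuotEquivDualAnnihilator
  have : FiniteDimensional k (LinearMap.ker μ).dualAnnihilator := Module.Finite.equiv e₂
  have : FiniteDimensional k (S ⊔ principal k F V).dualAnnihilator := Module.Finite.equiv e₃
  have key := Submodule.finite_and_finrank_le_of_map_le S.dualRestrict
    (integralMultiplier O x ⊔ principal k F V).dualAnnihilator (S ⊔ principal k F V).dualAnnihilator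
    (LinearMap.ker μ).dualAnnihilator ?_ ?_
  · rwa [← e₂.finrank_eq, ← e₃.finrank_eq, Subspace.dual_finrank_eq, Subspace.dual_finrank_eq,
      e₁.finrank_eq] at key
  · rintro _ ⟨ω, hω, rfl⟩
    rw [Submodule.mem_dualAnnihilator]
    intro b hb
    refine (Submodule.mem_dualAnnihilator _).1 hω _ (Submodule.mem_sup_left ⟨b.2, ?_⟩)
    exact (Submodule.Quotient.mk_eq_zero S).1 (LinearMap.mem_ker.1 hb)
  · rintro ω ⟨hω, hker⟩
    rw [SetLike.mem_coe, Submodule.mem_dualAnnihilator] at hω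
    rw [Submodule.mem_dualAnnihilator]
    intro v hv
    obtain ⟨a, ha, b, hb, rfl⟩ := Submodule.mem_sup.1 hv
    rw [map_add, hω b (Submodule.mem_sup_right hb), add_zero]
    exact LinearMap.congr_fun (LinearMap.mem_ker.1 hker) (⟨a, ha⟩ : S)

theorem exists_functionalSMul_add_eq_zero
    [FiniteDimensional k (V ⧸ (Subalgebra.toSubmodule O ⊔ principal k F V))]
    (hL : ∀ n : ℕ, ∃ x : F, FiniteDimensional k (boundedBy O x) ∧
      n < Module.finrank k (boundedBy O x))
    {ω₁ ω₂ : Module.Dual k V}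
    (h₁ : ω₁ ∈ (Subalgebra.toSubmodule O ⊔ principal k F V).dualAnnihilator)
    (h₂ : ω₂ ∈ (Subalgebra.toSubmodule O ⊔ principal k F V).dualAnnihilator) :
    ∃ p : F × F, p ≠ 0 ∧ functionalSMul ω₁ p.1 + functionalSMul ω₂ p.2 = 0 := by
  by_contra! hne
  obtain ⟨x, hfin, hlt⟩ :=
    hL (2 * Module.finrank k (V ⧸ (Subalgebra.toSubmodule O ⊔ principal k F V)))
  obtain ⟨hfin', hle⟩ := finrank_polarParts_le O (x := x)
  obtain ⟨hfin'', hle'⟩ := finrank_dualAnnihilator_integralMultiplier_le O (x := x)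
  let Φ : (boundedBy O x × boundedBy O x) →ₗ[k] Module.Dual k V :=
    ((functionalSMul ω₁).coprod (functionalSMul ω₂)) ∘ₗ
      ((boundedBy O x).subtype.prodMap (boundedBy O x).subtype)
  have hΦ : Function.Injective Φ := by
    rw [← LinearMap.ker_eq_bot, LinearMap.ker_eq_bot']
    rintro ⟨y, z⟩ h
    by_contra h0
    refine hne ((y : F), (z : F)) (fun h' => h0 ?_) h
    exact Prod.ext (Subtype.ext (congrArg Prod.fst h')) (Subtype.ext (congrArg Prod.snd h'))
  have kills {ω : Module.Dual k V}
      (h : ω ∈ (Subalgebra.toSubmodule O ⊔ principal k F V).dualAnnihilator)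
      {y : F} (hy : y ∈ boundedBy O x) :
      functionalSMul ω y ∈ (integralMultiplier O x ⊔ principal k F V).dualAnnihilator := by
    rw [Submodule.mem_dualAnnihilator] at h ⊢
    intro v hv
    obtain ⟨b, ⟨hb, hxb⟩, _, ⟨z, rfl⟩, rfl⟩ := Submodule.mem_sup.1 hv
    obtain ⟨a, ha, c, hc, hy⟩ := hy
    rw [functionalSMul_apply]
    refine h _ ?_
    rw [mul_add]
    refine Submodule.add_mem _ (Submodule.mem_sup_left ?_) (Submodule.mem_sup_right ?_)
    · rw [hy, add_mul, mul_right_comm]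
      exact O.add_mem (O.mul_mem ha hb) (O.mul_mem hxb hc)
    · exact ⟨y * z, map_mul (algebraMap F V) _ _⟩
  have hrange : LinearMap.range Φ ≤
      (integralMultiplier O x ⊔ principal k F V).dualAnnihilator := by
    rintro _ ⟨⟨y, z⟩, rfl⟩
    exact Submodule.add_mem _ (kills h₁ y.2) (kills h₂ z.2)
  have hdim := Submodule.finrank_mono hrange
  rw [LinearMap.finrank_range_of_inj hΦ, Module.finrank_prod] at hdim
  omega

theorem exists_functional_kills
    (hg : 1 < Module.finrank k (V ⧸ (Subalgebra.toSubmodule O ⊔ principal k F V)))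
    (hL : ∀ n : ℕ, ∃ x : F, FiniteDimensional k (boundedBy O x) ∧
      n < Module.finrank k (boundedBy O x)) :
    ∃ ω ∈ (Subalgebra.toSubmodule O ⊔ principal k F V).dualAnnihilator, ω ≠ 0 ∧
      ∃ f : F, f ∉ Set.range (algebraMap k F) ∧ ∀ v ∈ O, ω (algebraMap F V f * v) = 0 := by
  have hfin : FiniteDimensional k (V ⧸ (Subalgebra.toSubmodule O ⊔ principal k F V)) :=
    Module.finite_of_finrank_pos (by omega)
  have e := (Subalgebra.toSubmodule O ⊔ principal k F V).dualQuotEquivDualAnnihilator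
  have hΩfin := Module.Finite.equiv e
  have hΩ := e.finrank_eq
  rw [Subspace.dual_finrank_eq] at hΩ
  have : Nontrivial (Subalgebra.toSubmodule O ⊔ principal k F V).dualAnnihilator :=
    Module.nontrivial_of_finrank_pos (R := k) (by omega)
  obtain ⟨η₁, hne₁⟩ := exists_ne (0 : (Subalgebra.toSubmodule O ⊔ principal k F V).dualAnnihilator)
  obtain ⟨η₂, hne₂⟩ : ∃ ω, ω ∉ Submodule.span k {η₁} := by
    by_contra! h
    have h1 := finrank_span_singleton (K := k) (v := η₁) hne₁
    rw [Submodule.eq_top_iff'.2 h, finrank_top] at h1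
    omega
  obtain ⟨ω₁, hω₁⟩ := η₁
  obtain ⟨ω₂, hω₂⟩ := η₂
  have hne₁' : ω₁ ≠ 0 := fun h => hne₁ (Subtype.ext h)
  have hne₂' (r : k) : ω₂ ≠ r • ω₁ := fun h =>
    hne₂ (Submodule.mem_span_singleton.2 ⟨r, Subtype.ext h.symm⟩)
  obtain ⟨⟨a, b⟩, hab, hrel⟩ := exists_functionalSMul_add_eq_zero O hL hω₁ hω₂
  have hrel' (v : V) : ω₁ (algebraMap F V a * v) + ω₂ (algebraMap F V b * v) = 0 :=
    LinearMap.congr_fun hrel v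
  have hb : b ≠ 0 := by
    rintro rfl
    have ha : a ≠ 0 := fun h => hab (by rw [h]; rfl)
    refine hne₁' (LinearMap.ext fun v => ?_)
    have := hrel' (algebraMap F V a⁻¹ * v)
    rwa [← mul_assoc, ← map_mul, mul_inv_cancel₀ ha, map_one, one_mul, map_zero, zero_mul,
      map_zero, add_zero] at this
  have hf (v : V) : ω₁ (algebraMap F V (-a * b⁻¹) * v) = ω₂ v := by
    have h1 := hrel' (algebraMap F V b⁻¹ * v)
    rw [← mul_assoc, ← mul_assoc, ← map_mul, ← map_mul, mul_inv_cancel₀ hb, map_one, one_mul] at h1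
    rw [neg_mul, map_neg, neg_mul, map_neg]
    exact neg_eq_of_add_eq_zero_right h1
  refine ⟨ω₁, hω₁, hne₁', -a * b⁻¹, ?_, fun v hv => (hf v).trans
    ((Submodule.mem_dualAnnihilator _).1 hω₂ v (Submodule.mem_sup_left hv))⟩
  rintro ⟨r, hr⟩
  refine hne₂' r (LinearMap.ext fun v => ?_)
  rw [← hf, ← hr, ← IsScalarTower.algebraMap_apply, ← Algebra.smul_def, map_smul]
  rfl

theorem finrank_boundedBy_le
    [FiniteDimensional k (V ⧸ (Subalgebra.toSubmodule O ⊔ principal k F V))]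
    {ω : Module.Dual k V} (hω : ω ∈ (Subalgebra.toSubmodule O ⊔ principal k F V).dualAnnihilator)
    (hne : ω ≠ 0) {f : F} (hf : ∀ v ∈ O, ω (algebraMap F V f * v) = 0) :
    FiniteDimensional k (boundedBy O f) ∧ Module.finrank k (boundedBy O f) ≤
      Module.finrank k (V ⧸ (Subalgebra.toSubmodule O ⊔ principal k F V)) := by
  have e := (Subalgebra.toSubmodule O ⊔ principal k F V).dualQuotEquivDualAnnihilator
  have hΩfin := Module.Finite.equiv e
  have hΩ := e.finrank_eq
  rw [Subspace.dual_finrank_eq] at hΩ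
  rw [Submodule.mem_dualAnnihilator] at hω
  let Ψ : boundedBy O f →ₗ[k] Module.Dual k V := functionalSMul ω ∘ₗ (boundedBy O f).subtype
  have hΨ : Function.Injective Ψ := by
    rw [← LinearMap.ker_eq_bot, LinearMap.ker_eq_bot']
    rintro ⟨y, hy⟩ h
    by_contra h0
    have hy0 : y ≠ 0 := fun h' => h0 (Subtype.ext h')
    refine hne (LinearMap.ext fun v => ?_)
    have := LinearMap.congr_fun h (algebraMap F V y⁻¹ * v)
    change ω (algebraMap F V y * (algebraMap F V y⁻¹ * v)) = 0 at this
    rwa [← mul_assoc, ← map_mul, mul_inv_cancel₀ hy0, map_one, one_mul] at this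
  have hΨrange : LinearMap.range Ψ ≤
      (Subalgebra.toSubmodule O ⊔ principal k F V).dualAnnihilator := by
    rintro _ ⟨⟨y, a, ha, c, hc, hac⟩, rfl⟩
    rw [Submodule.mem_dualAnnihilator]
    intro v hv
    obtain ⟨o, ho, _, ⟨z, rfl⟩, rfl⟩ := Submodule.mem_sup.1 hv
    have h1 : ω (algebraMap F V y * o) = 0 := by
      rw [hac, add_mul, mul_assoc, map_add, hf _ (O.mul_mem hc ho),
        hω _ (Submodule.mem_sup_left (O.mul_mem ha ho)), add_zero]
    have h2 : ω (algebraMap F V y * algebraMap F V z) = 0 :=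
      hω _ (Submodule.mem_sup_right ⟨y * z, map_mul (algebraMap F V) _ _⟩)
    change ω (algebraMap F V y * (o + algebraMap F V z)) = 0
    rw [mul_add, map_add, h1, h2, add_zero]
  rw [hΩ]
  have : FiniteDimensional k (LinearMap.range Ψ) := Submodule.finiteDimensional_of_le hΨrange
  refine ⟨Module.Finite.equiv (LinearEquiv.ofInjective Ψ hΨ).symm, ?_⟩
  rw [← LinearMap.finrank_range_of_inj hΨ]
  exact Submodule.finrank_mono hΨrange

theorem finrank_polarParts_add_two_le
    [FiniteDimensional k (V ⧸ (Subalgebra.toSubmodule O ⊔ principal k F V))]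
    {ω : Module.Dual k V} (hω : ω ∈ (Subalgebra.toSubmodule O ⊔ principal k F V).dualAnnihilator)
    (hne : ω ≠ 0) {f : F} (hf : ∀ v ∈ O, ω (algebraMap F V f * v) = 0)
    [FiniteDimensional k (boundedBy O f)] :
    Module.finrank k (polarParts O f) + 2 ≤ Module.finrank k (boundedBy O f) +
      Module.finrank k (V ⧸ (Subalgebra.toSubmodule O ⊔ principal k F V)) := by
  rw [Submodule.mem_dualAnnihilator] at hω
  let ω' : (V ⧸ (Subalgebra.toSubmodule O ⊔ principal k F V)) →ₗ[k] k :=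
    (Subalgebra.toSubmodule O ⊔ principal k F V).liftQ ω fun v hv => LinearMap.mem_ker.2 (hω v hv)
  let κ : boundedBy O f →ₗ[k] (V ⧸ Subalgebra.toSubmodule O) :=
    ((Subalgebra.toSubmodule O).mkQ ∘ₗ (IsScalarTower.toAlgHom k F V).toLinearMap).domRestrict
      (boundedBy O f)
  have hκ : LinearMap.range κ = _ := LinearMap.range_domRestrict _ _
  obtain ⟨-, hle⟩ := Submodule.finite_and_finrank_le_of_map_le (modPrincipal O F)
    (polarParts O f) (LinearMap.range κ) (LinearMap.ker ω') (by
      rintro _ ⟨_, ⟨b, hb, rfl⟩, rfl⟩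
      exact hf b hb)
    ((polarParts_inf_ker_le O f).trans hκ.ge)
  have hker : Module.finrank k (LinearMap.ker ω') + 1 =
      Module.finrank k (V ⧸ (Subalgebra.toSubmodule O ⊔ principal k F V)) :=
    Module.Dual.finrank_ker_add_one_of_ne_zero fun h => hne <| LinearMap.ext fun v =>
      LinearMap.congr_fun h ((Subalgebra.toSubmodule O ⊔ principal k F V).mkQ v)
  have h1 : (1 : F) ∈ boundedBy O f := ⟨1, O.one_mem, 0, O.zero_mem, by simp⟩
  have hκ1 : κ ⟨1, h1⟩ = 0 := by
    refine (Submodule.Quotient.mk_eq_zero (Subalgebra.toSubmodule O)).2 ?_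
    change algebraMap F V 1 ∈ O
    rw [map_one]
    exact O.one_mem
  have hκker : 0 < Module.finrank k (LinearMap.ker κ) :=
    Module.finrank_pos_iff_exists_ne_zero.2
      ⟨(⟨⟨1, h1⟩, LinearMap.mem_ker.2 hκ1⟩ : LinearMap.ker κ), fun h =>
        one_ne_zero (α := F) (congrArg Subtype.val (congrArg Subtype.val h))⟩
  have := LinearMap.finrank_range_add_finrank_ker κ
  omega

/-- If `V / (O + F)` has finite dimension `g > 1`, then some nonconstant `f ∈ F` has at most a
`(2g - 2)`-dimensional space of polar parts. -/
theorem exists_finrank_polarParts_le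
    (hg : 1 < Module.finrank k (V ⧸ (Subalgebra.toSubmodule O ⊔ principal k F V)))
    (hL : ∀ n : ℕ, ∃ x : F, FiniteDimensional k (boundedBy O x) ∧
      n < Module.finrank k (boundedBy O x)) :
    ∃ f : F, f ∉ Set.range (algebraMap k F) ∧ FiniteDimensional k (polarParts O f) ∧
      Module.finrank k (polarParts O f) ≤
        2 * Module.finrank k (V ⧸ (Subalgebra.toSubmodule O ⊔ principal k F V)) - 2 := by
  have hfin : FiniteDimensional k (V ⧸ (Subalgebra.toSubmodule O ⊔ principal k F V)) :=
    Module.finite_of_finrank_pos (by omega)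
  obtain ⟨ω, hω, hne, f, hfk, hf⟩ := exists_functional_kills O hg hL
  obtain ⟨hLfin, hLle⟩ := finrank_boundedBy_le O hω hne hf
  have := finrank_polarParts_add_two_le O hω hne hf
  exact ⟨f, hfk, (finrank_polarParts_le O).1, by omega⟩

end Repartition

section Places

open IntermediateField.algebraAdjoinAdjoin

variable {k F}

theorem FFPlace.inv_mem (P : FFPlace k F) {x : F} (h : x ∉ P.asSubring) : x⁻¹ ∈ P.asSubring :=
  (P.asSubring.mem_or_inv_mem x).resolve_left h

theorem ne_zero_of_transcendental {z : F} (hz : Transcendental k z) : z ≠ 0 := by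
  rintro rfl
  exact hz isAlgebraic_zero

theorem exists_place_notMem {z : F} (hz : Transcendental k z) :
    ∃ P : FFPlace k F, z ∉ P.asSubring := by
  by_contra! h
  have hmem : z ∈ (integralClosure (Subring.closure (Set.range (algebraMap k F))) F).toSubring := by
    rw [← iInf_valuationSubring_superset, Subring.mem_iInf]
    rintro ⟨V, hV⟩
    by_cases hV' : V = ⊤
    · subst hV'
      exact ValuationSubring.mem_top z
    · exact h ⟨V, fun a => hV ⟨a, rfl⟩, hV'⟩
  refine hz (IsIntegral.isAlgebraic ?_)
  have hcl : Subring.closure (Set.range (algebraMap k F)) = (algebraMap k F).range := by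
    rw [← RingHom.coe_range, Subring.closure_eq]
  rw [hcl] at hmem
  obtain ⟨p, hp, hpz⟩ := hmem
  have hlift : p.map (algebraMap _ F) ∈ Polynomial.lifts (algebraMap k F) := by
    rw [Polynomial.lifts_iff_coeff_lifts]
    intro n
    rw [Polynomial.coeff_map]
    exact (p.coeff n).2
  obtain ⟨q, hq, -, hqm⟩ := Polynomial.lifts_and_natDegree_eq_and_monic hlift (hp.map _)
  refine ⟨q, hqm, ?_⟩
  rw [← Polynomial.eval_map, hq, Polynomial.eval_map]
  exact hpz

theorem mem_range_algebraMap_of_isAlgebraic [IsDomain (TensorProduct k (AlgebraicClosure k) F)]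
    {z : F} (hz : IsAlgebraic k z) : z ∈ Set.range (algebraMap k F) := by
  let E := k⟮z⟯
  have : FiniteDimensional k E := IntermediateField.adjoin.finiteDimensional hz.isIntegral
  let i : TensorProduct k (AlgebraicClosure k) E →ₐ[AlgebraicClosure k]
    TensorProduct k (AlgebraicClosure k) F := Algebra.TensorProduct.map (AlgHom.id _ _) E.val
  have hi : Function.Injective i :=
    Module.Flat.lTensor_preserves_injective_linearMap E.val.toLinearMap Subtype.val_injective
  have : IsDomain (TensorProduct k (AlgebraicClosure k) E) := hi.isDomain i.toRingHom
  have hbij := IsAlgClosed.algebraMap_bijective_of_isIntegral (k := AlgebraicClosure k)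
    (K := TensorProduct k (AlgebraicClosure k) E)
  have h1 : Module.finrank (AlgebraicClosure k) (TensorProduct k (AlgebraicClosure k) E) = 1 := by
    rw [← (LinearEquiv.ofBijective (Algebra.linearMap (AlgebraicClosure k)
      (TensorProduct k (AlgebraicClosure k) E)) hbij).finrank_eq,
      Module.finrank_self]
  rw [Module.finrank_baseChange] at h1
  have hz' : z ∈ E := IntermediateField.mem_adjoin_simple_self k z
  rw [IntermediateField.finrank_eq_one_iff.1 h1] at hz'
  exact IntermediateField.mem_bot.1 hz'

theorem transcendental_of_notMem_range [IsDomain (TensorProduct k (AlgebraicClosure k) F)]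
    {z : F} (hz : z ∉ Set.range (algebraMap k F)) : Transcendental k z :=
  fun h => hz (mem_range_algebraMap_of_isAlgebraic h)

theorem IsFunctionField.finiteDimensional (hF : IsFunctionField k F) {z : F}
    (hz : Transcendental k z) : FiniteDimensional k⟮z⟯ F := by
  obtain ⟨x, hx, hfin⟩ := hF
  have : Algebra.EssFiniteType k k⟮x⟯ := by
    rw [IntermediateField.essFiniteType_iff]
    exact IntermediateField.fg_adjoin_of_finite (Set.finite_singleton x)
  have : Algebra.EssFiniteType k F := Algebra.EssFiniteType.comp k k⟮x⟯ F
  have : Algebra.EssFiniteType k⟮z⟯ F := Algebra.EssFiniteType.of_comp k k⟮z⟯ F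
  have halg : Algebra.IsAlgebraic (Algebra.adjoin k {x}) F := by
    have : Algebra.IsAlgebraic k⟮x⟯ F := Algebra.IsAlgebraic.of_finite _ _
    exact Algebra.IsAlgebraic.trans _ k⟮x⟯ F
  have htr := Algebra.IsAlgebraic.trdeg_le_cardinalMk k ({x} : Set F)
  have hz' : AlgebraicIndependent k ((↑) : ({z} : Set F) → F) :=
    (algebraicIndependent_unique_type_iff (ι := ({z} : Set F))).2 hz
  have hb := hz'.isTranscendenceBasis_of_trdeg_le_of_finite (htr.trans (by simp))
  have := hb.isAlgebraic_field
  rw [Subtype.range_coe] at this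
  exact Algebra.finite_of_essFiniteType_of_isAlgebraic

end Places

section PoleSpaces

open IntermediateField.algebraAdjoinAdjoin Polynomial

variable {k F}

theorem linearIndependent_adjoin_of_aeval {ι : Type*} [Fintype ι] {x : F} {r : ι → F}
    (h : ∀ p : ι → k[X], ∑ i, aeval x (p i) * r i = 0 → p = 0) :
    LinearIndependent k⟮x⟯ r := by
  rw [← LinearIndependent.iff_fractionRing (Algebra.adjoin k {x}) k⟮x⟯,
    Fintype.linearIndependent_iff]
  intro g hg
  have hmem (i : ι) : ∃ p : k[X], aeval x p = g i := by
    have h := (Algebra.adjoin_singleton_eq_range_aeval k x).le (g i).2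
    exact h
  choose p hp using hmem
  have hp0 : p = 0 := h p <| by
    rw [← hg]
    exact Finset.sum_congr rfl fun i _ => by rw [hp, Algebra.smul_def]; rfl
  intro i
  refine Subtype.ext ?_
  rw [← hp, hp0]
  simp

/-- For a subalgebra `R` of `F` containing `x`, the quotient `R / xR`. -/
noncomputable def quotientMul (R : Subalgebra k F) (x : F) :
    Submodule k (F ⧸ (Subalgebra.toSubmodule R).map (LinearMap.mulLeft k x)) :=
  (Subalgebra.toSubmodule R).map (Submodule.mkQ _)

theorem X_pow_dvd_of_sum_aeval_mul_eq_zero {R : Subalgebra k F} {x : F} (hx : x ∈ R)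
    (hx0 : x ≠ 0) {ι : Type*} [Fintype ι] {r : ι → F} (hr : ∀ i, r i ∈ R)
    (hli : LinearIndependent k fun i =>
      ((Subalgebra.toSubmodule R).map (LinearMap.mulLeft k x)).mkQ (r i))
    (N : ℕ) : ∀ p : ι → k[X], ∑ i, aeval x (p i) * r i = 0 → ∀ i, X ^ N ∣ p i := by
  induction N with
  | zero => simp
  | succ N ih =>
    intro p hp
    have hsplit : ∑ i, (p i).coeff 0 • r i = - (x * ∑ i, aeval x (divX (p i)) * r i) := by
      rw [eq_neg_iff_add_eq_zero, ← hp, Finset.mul_sum, ← Finset.sum_add_distrib]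
      refine Finset.sum_congr rfl fun i _ => ?_
      conv_rhs => rw [← divX_mul_X_add (p i)]
      simp [Algebra.smul_def]
      ring
    have hR : ∑ i, aeval x (divX (p i)) * r i ∈ R :=
      R.sum_mem fun i _ => R.mul_mem (Algebra.adjoin_le
      (Set.singleton_subset_iff.2 hx) (aeval_mem_adjoin_singleton k x))  (hr i)
    have hcoeff : ∀ i, (p i).coeff 0 = 0 := by
      refine Fintype.linearIndependent_iff.1 hli _ ?_
      simp_rw [← map_smul]
      rw [← map_sum, Submodule.mkQ_apply, Submodule.Quotient.mk_eq_zero, hsplit]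
      exact Submodule.neg_mem _ ⟨_, hR, rfl⟩
    have hdiv := ih (fun i => divX (p i)) <| by
      have : x * ∑ i, aeval x (divX (p i)) * r i = 0 := by
        rw [← neg_eq_zero, ← hsplit]
        simp [hcoeff]
      exact (mul_eq_zero.1 this).resolve_left hx0
    intro i
    rw [← divX_mul_X_add (p i), hcoeff i, C_0, add_zero, pow_succ]
    exact mul_dvd_mul_right (hdiv i) X

theorem finiteDimensional_quotientMul {R : Subalgebra k F} {x : F} (hx : x ∈ R)
    (hx0 : x ≠ 0) [FiniteDimensional k⟮x⟯ F] : FiniteDimensional k (quotientMul R x) := by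
  have hrank : Module.rank k (quotientMul R x) ≤ Module.finrank k⟮x⟯ F := by
    refine rank_le fun s hs => ?_
    have hlift (i : s) : ∃ r ∈ R, Submodule.mkQ _ r = (i : quotientMul R x).1 := i.1.2
    choose r hr hri using hlift
    have hli : LinearIndependent k fun i =>
        ((Subalgebra.toSubmodule R).map (LinearMap.mulLeft k x)).mkQ (r i) := by
      simp_rw [hri]
      exact hs.map' (quotientMul R x).subtype (Submodule.ker_subtype _)
    have hli' : LinearIndependent k⟮x⟯ r := linearIndependent_adjoin_of_aeval fun p hp => by
      funext i
      refine eq_zero_of_dvd_of_natDegree_lt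
        (X_pow_dvd_of_sum_aeval_mul_eq_zero hx hx0 hr hli ((p i).natDegree + 1) p hp i) ?_
      simp
    simpa using hli'.fintype_card_le_finrank
  exact Module.rank_lt_aleph0_iff.1 (hrank.trans_lt (Cardinal.natCast_lt_aleph0))

/-- The elements of `F` whose poles are poles of `x`, of order at most `n` times that of `x`. -/
def poleBound (x : F) (n : ℕ) : Submodule k F where
  carrier := {y | ∀ P : FFPlace k F, (x ∈ P.asSubring → y ∈ P.asSubring) ∧
    (x ∉ P.asSubring → y * x⁻¹ ^ n ∈ P.asSubring)}
  zero_mem' P := ⟨fun _ => zero_mem _, fun _ => by rw [zero_mul]; exact zero_mem _⟩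
  add_mem' ha hb P := ⟨fun h => add_mem ((ha P).1 h) ((hb P).1 h), fun h => by
    rw [add_mul]; exact add_mem ((ha P).2 h) ((hb P).2 h)⟩
  smul_mem' c y hy P := ⟨fun h => by
    rw [Algebra.smul_def]; exact mul_mem (P.algebraMap_mem c) ((hy P).1 h), fun h => by
    rw [Algebra.smul_def, mul_assoc]; exact mul_mem (P.algebraMap_mem c) ((hy P).2 h)⟩

/-- The elements of `F` all of whose poles are poles of `x`. -/
def regularAwayFrom (k : Type*) {F : Type*} [Field k] [Field F] [Algebra k F] (x : F) :
    Subalgebra k F where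
  carrier := {y | ∀ P : FFPlace k F, x ∈ P.asSubring → y ∈ P.asSubring}
  mul_mem' ha hb P h := mul_mem (ha P h) (hb P h)
  add_mem' ha hb P h := add_mem (ha P h) (hb P h)
  algebraMap_mem' c P _ := P.algebraMap_mem c

theorem mem_regularAwayFrom (x : F) : x ∈ regularAwayFrom k x := fun _ h => h

theorem isAlgebraic_of_mem_places {z : F} (h : ∀ P : FFPlace k F, z ∈ P.asSubring) :
    IsAlgebraic k z := by
  by_contra hz
  obtain ⟨P, hP⟩ := exists_place_notMem hz
  exact hP (h P)

theorem poleBound_inf_eq_bot [IsDomain (TensorProduct k (AlgebraicClosure k) F)] {x : F}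
    (hx : Transcendental k x) (n : ℕ) :
    poleBound x n ⊓ (Subalgebra.toSubmodule (regularAwayFrom k x)).map
      (LinearMap.mulLeft k (x ^ (n + 1))) = ⊥ := by
  rw [eq_bot_iff]
  rintro _ ⟨hy, r, hr, rfl⟩
  have hx0 : x ≠ 0 := ne_zero_of_transcendental hx
  rw [SetLike.mem_coe] at hy
  have hrx (P : FFPlace k F) (hP : x ∉ P.asSubring) : r * x ∈ P.asSubring := by
    have := (hy P).2 hP
    rwa [LinearMap.mulLeft_apply, pow_succ, inv_pow,
      show x ^ n * x * r * (x ^ n)⁻¹ = r * x by field_simp] at this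
  have hint (P : FFPlace k F) : r ∈ P.asSubring := by
    by_cases hP : x ∈ P.asSubring
    · exact hr P hP
    · have := mul_mem (hrx P hP) (P.inv_mem hP)
      rwa [mul_assoc, mul_inv_cancel₀ hx0, mul_one] at this
  obtain ⟨c, rfl⟩ := mem_range_algebraMap_of_isAlgebraic (isAlgebraic_of_mem_places hint)
  by_cases hc : c = 0
  · simp [hc]
  obtain ⟨P, hP⟩ := exists_place_notMem hx
  refine absurd ?_ hP
  have := mul_mem (P.algebraMap_mem c⁻¹) (hrx P hP)
  rwa [← mul_assoc, ← map_mul, inv_mul_cancel₀ hc, map_one, one_mul] at this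

theorem finiteDimensional_poleBound [IsDomain (TensorProduct k (AlgebraicClosure k) F)] {x : F}
    (hx : Transcendental k x) [FiniteDimensional k⟮x⟯ F] (n : ℕ) :
    FiniteDimensional k (poleBound (k := k) x n) := by
  have hx0 : x ≠ 0 := ne_zero_of_transcendental hx
  let R := regularAwayFrom k x
  let W (j : ℕ) : Submodule k F := poleBound x n ⊓
    (Subalgebra.toSubmodule R).map (LinearMap.mulLeft k (x ^ j))
  have hquot := finiteDimensional_quotientMul (mem_regularAwayFrom (k := k) x) hx0
  have hstep (j : ℕ) (hj : FiniteDimensional k (W (j + 1))) : FiniteDimensional k (W j) := by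
    refine (Submodule.finite_and_finrank_le_of_map_le
      ((Submodule.mkQ ((Subalgebra.toSubmodule R).map (LinearMap.mulLeft k x))) ∘ₗ
        LinearMap.mulLeft k (x ^ j)⁻¹) (W j) (W (j + 1)) (quotientMul R x) ?_ ?_).1
    · rintro _ ⟨_, ⟨-, r, hr, rfl⟩, rfl⟩
      refine ⟨r, hr, ?_⟩
      simp [hx0]
    · rintro _ ⟨⟨hy, r, hr, rfl⟩, hker⟩
      refine ⟨hy, ?_⟩
      rw [SetLike.mem_coe, LinearMap.mem_ker, LinearMap.comp_apply, Submodule.mkQ_apply,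
        Submodule.Quotient.mk_eq_zero] at hker
      obtain ⟨s, hs, hsr⟩ := hker
      refine ⟨s, hs, ?_⟩
      simp only [LinearMap.mulLeft_apply] at hsr ⊢
      rw [pow_succ, mul_assoc, hsr, mul_inv_cancel_left₀ (pow_ne_zero _ hx0)]
  have hall (j : ℕ) (hj : j ≤ n + 1) : FiniteDimensional k (W j) := by
    induction hj using Nat.decreasingInduction with
    | of_succ j _ ih => exact hstep j ih
    | self =>
      have : W (n + 1) = ⊥ := poleBound_inf_eq_bot hx n
      rw [this]
      infer_instance
  have h0 : W 0 = poleBound x n := by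
    refine inf_eq_left.2 fun y hy => ⟨y, fun P hP => (hy P).1 hP, ?_⟩
    simp
  rw [← h0]
  exact hall 0 (Nat.zero_le _)

theorem pow_mem_poleBound (x : F) {i n : ℕ} (h : i ≤ n) :
    x ^ i ∈ poleBound (k := k) x n := by
  refine fun P => ⟨fun hP => pow_mem hP i, fun hP => ?_⟩
  have hx0 : x ≠ 0 := fun h0 => hP (h0 ▸ zero_mem _)
  obtain ⟨j, rfl⟩ := Nat.exists_eq_add_of_le h
  rw [pow_add, ← mul_assoc, ← mul_pow, mul_inv_cancel₀ hx0, one_pow, one_mul]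
  exact pow_mem (P.inv_mem hP) j

theorem linearIndependent_pow_of_transcendental {x : F} (hx : Transcendental k x) :
    LinearIndependent k fun i : ℕ => x ^ i := by
  have h := (basisMonomials k).linearIndependent.map' (aeval x).toLinearMap
    (LinearMap.ker_eq_bot.2 (transcendental_iff_injective.1 hx))
  have heq : (aeval x).toLinearMap ∘ basisMonomials k = fun i : ℕ => x ^ i := by
    funext i
    simp
  rwa [heq] at h

theorem lt_finrank_poleBound {x : F} (hx : Transcendental k x) (n : ℕ)
    [FiniteDimensional k (poleBound (k := k) x n)] :
    n < Module.finrank k (poleBound (k := k) x n) := by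
  have hli : LinearIndependent k fun i : Fin (n + 1) =>
      (⟨x ^ (i : ℕ), pow_mem_poleBound x (Nat.lt_succ_iff.1 i.2)⟩ : poleBound (k := k) x n) := by
    refine LinearIndependent.of_comp (poleBound x n).subtype ?_
    exact (linearIndependent_pow_of_transcendental hx).comp _ Fin.val_injective
  simpa using hli.fintype_card_le_finrank

end PoleSpaces

section Adeles

variable {k F}

/-- The adeles bounded by the polar divisor of `f`. -/
def adelePoleBound (f : F) : Submodule k (FFPlace k F → F) where
  carrier := {α | α ∈ adeleSubmodule k F ∧ ∀ P : FFPlace k F,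
    (f ∈ P.asSubring → α P ∈ P.asSubring) ∧ (f ∉ P.asSubring → α P * f⁻¹ ∈ P.asSubring)}
  zero_mem' := ⟨zero_mem _, fun P => ⟨fun _ => zero_mem _, fun _ => by
    rw [Pi.zero_apply, zero_mul]; exact zero_mem _⟩⟩
  add_mem' ha hb := ⟨add_mem ha.1 hb.1, fun P => ⟨
    fun h => add_mem ((ha.2 P).1 h) ((hb.2 P).1 h), fun h => by
      rw [Pi.add_apply, add_mul]; exact add_mem ((ha.2 P).2 h) ((hb.2 P).2 h)⟩⟩
  smul_mem' c α hα := ⟨Submodule.smul_mem _ c hα.1, fun P => ⟨fun h => by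
      rw [Pi.smul_apply, Algebra.smul_def]
      exact mul_mem (P.algebraMap_mem c) ((hα.2 P).1 h), fun h => by
      rw [Pi.smul_apply, Algebra.smul_def, mul_assoc]
      exact mul_mem (P.algebraMap_mem c) ((hα.2 P).2 h)⟩⟩

theorem finiteDimensional_map_adeleSubmodule (hg : 0 < genus k F) :
    FiniteDimensional k
      ((adeleSubmodule k F).map (integralAdeles k F ⊔ principalAdeles k F).mkQ) := by
  have : FiniteDimensional k (↥(adeleSubmodule k F) ⧸
      ((integralAdeles k F ⊔ principalAdeles k F).comap (adeleSubmodule k F).subtype)) :=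
    Module.finite_of_finrank_pos hg
  let T := Submodule.mapQ
    ((integralAdeles k F ⊔ principalAdeles k F).comap (adeleSubmodule k F).subtype)
    (integralAdeles k F ⊔ principalAdeles k F) (adeleSubmodule k F).subtype le_rfl
  refine Submodule.finiteDimensional_of_le (S₂ := LinearMap.range T) ?_
  rintro _ ⟨α, hα, rfl⟩
  exact ⟨Submodule.Quotient.mk ⟨α, hα⟩, rfl⟩

theorem finiteDimensional_map_adelePoleBound (hg : 0 < genus k F) {f : F}
    [FiniteDimensional k (poleBound (k := k) f 1)] :
    FiniteDimensional k ((adelePoleBound f).map (integralAdeles k F).mkQ) := by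
  have := finiteDimensional_map_adeleSubmodule hg
  refine (Submodule.finite_and_finrank_le_of_map_le
    (Submodule.factor (le_sup_left : integralAdeles k F ≤ _ ⊔ principalAdeles k F)) _
    ((poleBound f 1).map ((integralAdeles k F).mkQ ∘ₗ
      LinearMap.pi fun _ : FFPlace k F => (LinearMap.id : F →ₗ[k] F)))
    ((adeleSubmodule k F).map (integralAdeles k F ⊔ principalAdeles k F).mkQ) ?_ ?_).1
  · rintro _ ⟨_, ⟨α, hα, rfl⟩, rfl⟩
    exact ⟨α, hα.1, rfl⟩
  · rintro _ ⟨⟨α, hα, rfl⟩, hker⟩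
    have hmem : α ∈ integralAdeles k F ⊔ principalAdeles k F :=
      (Submodule.Quotient.mk_eq_zero _).1 hker
    obtain ⟨ι, hι, _, ⟨y, rfl⟩, rfl⟩ := Submodule.mem_sup.1 hmem
    refine ⟨y, fun P => ⟨fun hP => ?_, fun hP => ?_⟩, ?_⟩
    · have := sub_mem ((hα.2 P).1 hP) (hι P)
      simpa using this
    · have := sub_mem ((hα.2 P).2 hP) (mul_mem (hι P) (P.inv_mem hP))
      simpa [add_mul] using this
    · have hι0 : (integralAdeles k F).mkQ ι = 0 := (Submodule.Quotient.mk_eq_zero _).2 hι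
      rw [map_add, hι0, zero_add]
      rfl

open Classical in
theorem single_mem_adelePoleBound {f : F} {P : FFPlace k F} (hP : f ∉ P.asSubring) :
    Pi.single P f ∈ adelePoleBound (k := k) f := by
  have hf : f ≠ 0 := fun h0 => hP (h0 ▸ zero_mem _)
  refine ⟨(Set.finite_singleton P).subset fun Q hQ => ?_, fun Q => ?_⟩
  · by_contra h
    exact hQ (by rw [Pi.single_eq_of_ne h]; exact zero_mem _)
  · by_cases h : Q = P
    · subst h
      refine ⟨fun hQ => absurd hQ hP, fun _ => ?_⟩
      rw [Pi.single_eq_same, mul_inv_cancel₀ hf]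
      exact one_mem _
    · rw [Pi.single_eq_of_ne h, zero_mul]
      exact ⟨fun _ => zero_mem _, fun _ => zero_mem _⟩

open Classical in
theorem linearIndependent_mkQ_single (f : F) :
    LinearIndependent k fun P : {P : FFPlace k F // f ∉ P.asSubring} =>
      (integralAdeles k F).mkQ (Pi.single P.1 f) := by
  rw [linearIndependent_iff']
  intro s c hc P hPs
  simp_rw [← map_smul] at hc
  rw [← map_sum, Submodule.mkQ_apply, Submodule.Quotient.mk_eq_zero] at hc
  have h := hc P.1
  rw [Finset.sum_apply, Finset.sum_eq_single P] at h
  · by_contra hcP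
    rw [Pi.smul_apply, Pi.single_eq_same, Algebra.smul_def] at h
    have := mul_mem (P.1.algebraMap_mem (c P)⁻¹) h
    rw [← mul_assoc, ← map_mul, inv_mul_cancel₀ hcP, map_one, one_mul] at this
    exact P.2 this
  · intro Q _ hQ
    rw [Pi.smul_apply, Pi.single_eq_of_ne fun h => hQ (Subtype.ext h.symm), smul_zero]
  · exact fun h => absurd hPs h

theorem finite_poles [IsDomain (TensorProduct k (AlgebraicClosure k) F)]
    (hF : IsFunctionField k F) (hg : 0 < genus k F) (f : F) :
    {P : FFPlace k F | f ∉ P.asSubring}.Finite := by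
  classical
  by_cases hf : IsAlgebraic k f
  · obtain ⟨c, rfl⟩ := mem_range_algebraMap_of_isAlgebraic hf
    exact Set.finite_empty.subset fun P hP => hP (P.algebraMap_mem c)
  have := hF.finiteDimensional hf
  have := finiteDimensional_poleBound hf 1
  have := finiteDimensional_map_adelePoleBound hg (f := f)
  have hli : LinearIndependent k fun P : {P : FFPlace k F // f ∉ P.asSubring} =>
      (⟨(integralAdeles k F).mkQ (Pi.single P.1 f), _, single_mem_adelePoleBound P.2, rfl⟩ :
        (adelePoleBound f).map (integralAdeles k F).mkQ) :=
    LinearIndependent.of_comp (Submodule.subtype _) (linearIndependent_mkQ_single f)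
  exact hli.finite_of_isNoetherian

/-- The ring of adeles of `F/k`, as an algebra over `F`. -/
def adeleAlgebra (h : ∀ f : F, {P : FFPlace k F | f ∉ P.asSubring}.Finite) :
    Subalgebra F (FFPlace k F → F) where
  carrier := {α | {P : FFPlace k F | α P ∉ P.asSubring}.Finite}
  add_mem' ha hb := (adeleSubmodule k F).add_mem ha hb
  mul_mem' {a b} ha hb := by
    refine Set.Finite.subset (ha.union hb) fun P hP => ?_
    by_contra hn
    rw [Set.mem_union, not_or] at hn
    exact hP (mul_mem (not_not.1 hn.1) (not_not.1 hn.2))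
  algebraMap_mem' := h

variable (h : ∀ f : F, {P : FFPlace k F | f ∉ P.asSubring}.Finite)

/-- The everywhere integral elements of the ring of adeles. -/
def integralAdeleAlgebra : Subalgebra k (adeleAlgebra h) where
  carrier := {α | ∀ P : FFPlace k F, α.1 P ∈ P.asSubring}
  mul_mem' ha hb P := mul_mem (ha P) (hb P)
  add_mem' ha hb P := add_mem (ha P) (hb P)
  algebraMap_mem' c P := P.algebraMap_mem c

theorem genus_eq_finrank : genus k F = Module.finrank k (adeleAlgebra h ⧸
    (Subalgebra.toSubmodule (integralAdeleAlgebra h) ⊔ principal k F (adeleAlgebra h))) := by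
  let e : adeleSubmodule k F ≃ₗ[k] adeleAlgebra h :=
    { toFun := fun α => ⟨α.1, α.2⟩
      invFun := fun α => ⟨α.1, α.2⟩
      map_add' := fun _ _ => rfl
      map_smul' := fun _ _ => rfl
      left_inv := fun _ => rfl
      right_inv := fun _ => rfl }
  refine LinearEquiv.finrank_eq (Submodule.Quotient.equiv _ _ e ?_)
  ext α
  rw [Submodule.mem_map_equiv, Submodule.mem_comap, Submodule.mem_sup, Submodule.mem_sup]
  constructor
  · rintro ⟨ι, hι, _, ⟨y, rfl⟩, hy⟩
    exact ⟨⟨ι, Set.finite_empty.subset fun P (hP : ι P ∉ P.asSubring) => hP (hι P)⟩, hι, _,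
      ⟨y, rfl⟩, Subtype.ext hy⟩
  · rintro ⟨ι, hι, _, ⟨y, rfl⟩, hy⟩
    exact ⟨ι.1, hι, _, ⟨y, rfl⟩, congrArg Subtype.val hy⟩

open Classical in
/-- The idempotent adele supported on the places where `x` is integral. -/
noncomputable def integralIndicator (x : F) : adeleAlgebra h :=
  ⟨fun P => if x ∈ P.asSubring then 1 else 0, Set.finite_empty.subset fun P hP => hP (by
    show ite _ _ _ ∈ _
    split_ifs
    exacts [one_mem _, zero_mem _])⟩

theorem integralIndicator_apply_of_mem {x : F} {P : FFPlace k F} (hP : x ∈ P.asSubring) :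
    (integralIndicator h x).1 P = 1 := if_pos hP

theorem integralIndicator_apply_of_notMem {x : F} {P : FFPlace k F} (hP : x ∉ P.asSubring) :
    (integralIndicator h x).1 P = 0 := if_neg hP

theorem boundedBy_eq_poleBound {x : F} (hx : x ≠ 0) (n : ℕ) :
    boundedBy (integralAdeleAlgebra h) (x ^ n) = poleBound x n := by
  ext y
  constructor
  · rintro ⟨a, ha, c, hc, hy⟩ P
    have hyP : y = a.1 P + x ^ n * c.1 P := congrFun (congrArg Subtype.val hy) P
    refine ⟨fun hP => ?_, fun hP => ?_⟩
    · rw [hyP]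
      exact add_mem (ha P) (mul_mem (pow_mem hP n) (hc P))
    · have : y * x⁻¹ ^ n = a.1 P * x⁻¹ ^ n + c.1 P := by
        rw [hyP, add_mul, mul_right_comm, ← mul_pow, mul_inv_cancel₀ hx, one_pow, one_mul]
      rw [this]
      exact add_mem (mul_mem (ha P) (pow_mem (P.inv_mem hP) n)) (hc P)
  · intro hy
    refine ⟨algebraMap F _ y * integralIndicator h x, fun P => ?_,
      algebraMap F _ (y * x⁻¹ ^ n) * (1 - integralIndicator h x), fun P => ?_, ?_⟩
    · show y * (integralIndicator h x).1 P ∈ _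
      by_cases hP : x ∈ P.asSubring
      · rw [integralIndicator_apply_of_mem h hP, mul_one]
        exact (hy P).1 hP
      · rw [integralIndicator_apply_of_notMem h hP, mul_zero]
        exact zero_mem _
    · show y * x⁻¹ ^ n * (1 - (integralIndicator h x).1 P) ∈ _
      by_cases hP : x ∈ P.asSubring
      · rw [integralIndicator_apply_of_mem h hP, sub_self, mul_zero]
        exact zero_mem _
      · rw [integralIndicator_apply_of_notMem h hP, sub_zero, mul_one]
        exact (hy P).2 hP
    · rw [← mul_assoc, ← map_mul, mul_left_comm, ← mul_pow, mul_inv_cancel₀ hx, one_pow, mul_one]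
      ring

end Adeles

section DegreeBound

open IntermediateField.algebraAdjoinAdjoin Polynomial

variable {k F}

theorem finrank_poleBound_zero_le [IsDomain (TensorProduct k (AlgebraicClosure k) F)] (x : F) :
    Module.finrank k (poleBound (k := k) x 0) ≤ 1 := by
  have hle : poleBound (k := k) x 0 ≤ Submodule.span k {1} := by
    intro y hy
    have hint (P : FFPlace k F) : y ∈ P.asSubring := by
      by_cases hP : x ∈ P.asSubring
      · exact (hy P).1 hP
      · simpa using (hy P).2 hP
    obtain ⟨c, rfl⟩ := mem_range_algebraMap_of_isAlgebraic (isAlgebraic_of_mem_places hint)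
    exact Submodule.mem_span_singleton.2 ⟨c, (Algebra.algebraMap_eq_smul_one c).symm⟩
  exact (Submodule.finrank_mono hle).trans (finrank_span_singleton one_ne_zero).le

theorem mul_mem_poleBound {x y z : F} {m n : ℕ} (hy : y ∈ poleBound (k := k) x m)
    (hz : z ∈ poleBound (k := k) x n) : y * z ∈ poleBound (k := k) x (m + n) := by
  refine fun P => ⟨fun hP => mul_mem ((hy P).1 hP) ((hz P).1 hP), fun hP => ?_⟩
  rw [pow_add, mul_mul_mul_comm]
  exact mul_mem ((hy P).2 hP) ((hz P).2 hP)

theorem poleBound_mono (x : F) {m n : ℕ} (h : m ≤ n) :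
    poleBound (k := k) x m ≤ poleBound x n := by
  intro y hy
  obtain ⟨j, rfl⟩ := Nat.exists_eq_add_of_le h
  simpa using mul_mem_poleBound hy (pow_mem_poleBound x (Nat.zero_le j))

theorem aeval_mem_poleBound (x : F) {p : k[X]} {n : ℕ} (h : p.natDegree ≤ n) :
    aeval x p ∈ poleBound (k := k) x n := by
  rw [aeval_eq_sum_range]
  refine Submodule.sum_mem _ fun i hi => Submodule.smul_mem _ _ (pow_mem_poleBound x ?_)
  exact (Nat.lt_succ_iff.1 (Finset.mem_range.1 hi)).trans h

theorem mul_mem_of_eval_eq_zero (A : ValuationSubring F) {p : F[X]}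
    (hp : p.Monic) {u t : F} (hu : p.eval u = 0) (ht : t ∈ A)
    (hcoeff : ∀ i, p.coeff i * t ∈ A) : u * t ∈ A := by
  by_cases huA : u ∈ A
  · exact mul_mem huA ht
  have hu0 : u ≠ 0 := fun h => huA (h ▸ zero_mem _)
  obtain ⟨e, he⟩ : ∃ e, p.natDegree = e + 1 := by
    refine Nat.exists_eq_succ_of_ne_zero fun h0 => ?_
    rw [hp.natDegree_eq_zero.1 h0, eval_one] at hu
    exact one_ne_zero hu
  have hpow : u ^ (e + 1) = - ∑ i ∈ Finset.range (e + 1), p.coeff i * u ^ i := by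
    have h := congrArg (eval u) hp.as_sum
    rw [hu, he, eval_add, eval_finsetSum] at h
    rw [eq_neg_iff_add_eq_zero, h]
    simp
  have hut : u * t = - ∑ i ∈ Finset.range (e + 1), p.coeff i * t * u⁻¹ ^ (e - i) := by
    rw [← mul_left_inj' (pow_ne_zero e hu0), mul_right_comm, ← pow_succ', hpow, neg_mul, neg_mul,
      Finset.sum_mul, Finset.sum_mul]
    congr 1
    refine Finset.sum_congr rfl fun i hi => ?_
    obtain ⟨j, rfl⟩ := Nat.exists_eq_add_of_le (Nat.lt_succ_iff.1 (Finset.mem_range.1 hi))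
    rw [Nat.add_sub_cancel_left, pow_add, inv_pow]
    field_simp
  rw [hut]
  exact neg_mem (sum_mem fun i _ => mul_mem (hcoeff i)
    (pow_mem ((A.mem_or_inv_mem u).resolve_left huA) _))

theorem exists_mem_poleBound_of_isIntegral {x u : F}
    (hu : IsIntegral (Algebra.adjoin k {x}) u) : ∃ n, u ∈ poleBound (k := k) x n := by
  obtain ⟨p, hp, hpu⟩ := hu
  have hcoeff (i : ℕ) : ∃ q : k[X], aeval x q = p.coeff i :=
    (Algebra.adjoin_singleton_eq_range_aeval k x).le (p.coeff i).2
  choose q hq using hcoeff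
  let n := (Finset.range (p.natDegree + 1)).sup fun i => (q i).natDegree
  have hmem (i : ℕ) : (p.map (algebraMap (Algebra.adjoin k {x}) F)).coeff i ∈
      poleBound (k := k) x n := by
    rw [coeff_map]
    by_cases hi : i ≤ p.natDegree
    · have := aeval_mem_poleBound x (p := q i) (n := n)
        (Finset.le_sup (f := fun i => (q i).natDegree)
          (Finset.mem_range.2 (Nat.lt_succ_iff.2 hi)))
      rwa [hq] at this
    · rw [coeff_eq_zero_of_natDegree_lt (not_le.1 hi), map_zero]
      exact zero_mem _
  have heval : (p.map (algebraMap (Algebra.adjoin k {x}) F)).eval u = 0 := by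
    rw [eval_map]
    exact hpu
  refine ⟨n, fun P => ⟨fun hP => ?_, fun hP => ?_⟩⟩
  · have := mul_mem_of_eval_eq_zero P.asSubring (hp.map _) heval (one_mem _) fun i => by
      rw [mul_one]
      exact (hmem i P).1 hP
    rwa [mul_one] at this
  · exact mul_mem_of_eval_eq_zero P.asSubring (hp.map _) heval (pow_mem (P.inv_mem hP) n)
      fun i => (hmem i P).2 hP

theorem exists_linearIndependent_mem_poleBound {x : F} [FiniteDimensional k⟮x⟯ F] :
    ∃ (n : ℕ) (u : Fin (Module.finrank k⟮x⟯ F) → F), LinearIndependent k⟮x⟯ u ∧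
      ∀ j, u j ∈ poleBound (k := k) x n := by
  classical
  let b := Module.finBasis k⟮x⟯ F
  have : Algebra.IsAlgebraic (Algebra.adjoin k {x}) F := by
    have : Algebra.IsAlgebraic k⟮x⟯ F := Algebra.IsAlgebraic.of_finite _ _
    exact Algebra.IsAlgebraic.trans _ k⟮x⟯ F
  obtain ⟨a, ha, hint⟩ := Algebra.IsAlgebraic.exists_integral_multiples
    (R := Algebra.adjoin k {x}) (Finset.univ.image b)
  have hu (j) : ∃ n, a • b j ∈ poleBound (k := k) x n :=
    exists_mem_poleBound_of_isIntegral
      (hint _ (Finset.mem_image_of_mem b (Finset.mem_univ j)))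
  choose n hn using hu
  have ha' : algebraMap (Algebra.adjoin k {x}) k⟮x⟯ a ≠ 0 :=
    (map_ne_zero_iff _ (FaithfulSMul.algebraMap_injective _ _)).2 ha
  refine ⟨Finset.univ.sup n, fun j => a • b j, ?_, fun j =>
    poleBound_mono x (Finset.le_sup (Finset.mem_univ j)) (hn j)⟩
  have := b.linearIndependent.units_smul fun _ => Units.mk0 _ ha'
  exact this

theorem mul_finrank_le_finrank_poleBound [IsDomain (TensorProduct k (AlgebraicClosure k) F)]
    {x : F} (hx : Transcendental k x) [FiniteDimensional k⟮x⟯ F] :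
    ∃ n : ℕ, ∀ N : ℕ, N * Module.finrank k⟮x⟯ F ≤
      Module.finrank k (poleBound (k := k) x (N + n)) := by
  obtain ⟨n, u, hu, hmem⟩ := exists_linearIndependent_mem_poleBound (k := k) (x := x)
  refine ⟨n, fun N => ?_⟩
  have := finiteDimensional_poleBound hx (N + n)
  have hpow : LinearIndependent k fun i : Fin N => AdjoinSimple.gen k x ^ (i : ℕ) :=
    LinearIndependent.of_comp k⟮x⟯.val.toLinearMap
      ((linearIndependent_pow_of_transcendental hx).comp _ Fin.val_injective)
  have hprod : LinearIndependent k fun p : Fin N × Fin (Module.finrank k⟮x⟯ F) =>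
      x ^ (p.1 : ℕ) * u p.2 := by
    have h := linearIndependent_smul hpow hu
    simpa only [IntermediateField.smul_def, SubmonoidClass.coe_pow, AdjoinSimple.coe_gen,
      smul_eq_mul] using h
  have hli : LinearIndependent k fun p : Fin N × Fin (Module.finrank k⟮x⟯ F) =>
      (⟨x ^ (p.1 : ℕ) * u p.2, mul_mem_poleBound (pow_mem_poleBound x p.1.2.le) (hmem p.2)⟩ :
        poleBound (k := k) x (N + n)) :=
    LinearIndependent.of_comp (Submodule.subtype _) hprod
  simpa using hli.fintype_card_le_finrank

variable (h : ∀ f : F, {P : FFPlace k F | f ∉ P.asSubring}.Finite)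

theorem finrank_poleBound_succ_le [IsDomain (TensorProduct k (AlgebraicClosure k) F)] {x : F}
    (hx : x ≠ 0) (n : ℕ) [FiniteDimensional k (poleBound (k := k) x n)]
    [FiniteDimensional k (polarParts (integralAdeleAlgebra h) x)] :
    Module.finrank k (poleBound (k := k) x (n + 1)) ≤ Module.finrank k (poleBound (k := k) x n) +
      Module.finrank k (polarParts (integralAdeleAlgebra h) x) := by
  let T : F →ₗ[k] (adeleAlgebra h ⧸ Subalgebra.toSubmodule (integralAdeleAlgebra h)) :=
    (Subalgebra.toSubmodule (integralAdeleAlgebra h)).mkQ ∘ₗ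
      LinearMap.mulLeft k ((1 - integralIndicator h x) * algebraMap F _ (x⁻¹ ^ n)) ∘ₗ
        (IsScalarTower.toAlgHom k F (adeleAlgebra h)).toLinearMap
  refine (Submodule.finite_and_finrank_le_of_map_le T _ _ _ ?_ ?_).2
  · rintro _ ⟨y, hy, rfl⟩
    refine ⟨(1 - integralIndicator h x) * algebraMap F _ (y * x⁻¹ ^ (n + 1)), fun P => ?_, ?_⟩
    · show (1 - (integralIndicator h x).1 P) * (y * x⁻¹ ^ (n + 1)) ∈ P.asSubring
      by_cases hP : x ∈ P.asSubring
      · rw [integralIndicator_apply_of_mem h hP, sub_self, zero_mul]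
        exact zero_mem _
      · rw [integralIndicator_apply_of_notMem h hP, sub_zero, one_mul]
        exact (hy P).2 hP
    · refine congrArg (Submodule.mkQ _) (Subtype.ext (funext fun P => ?_))
      show x * ((1 - (integralIndicator h x).1 P) * (y * x⁻¹ ^ (n + 1))) =
        (1 - (integralIndicator h x).1 P) * x⁻¹ ^ n * y
      rw [pow_succ]
      field_simp
  · rintro y ⟨hy, hker⟩ P
    refine ⟨(hy P).1, fun hP => ?_⟩
    have := (Submodule.Quotient.mk_eq_zero _).1 hker P
    change (1 - (integralIndicator h x).1 P) * x⁻¹ ^ n * y ∈ P.asSubring at this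
    rwa [integralIndicator_apply_of_notMem h hP, sub_zero, one_mul, mul_comm] at this

theorem finrank_adjoin_le_finrank_polarParts
    [IsDomain (TensorProduct k (AlgebraicClosure k) F)] {x : F} (hx : Transcendental k x)
    [FiniteDimensional k⟮x⟯ F] [FiniteDimensional k (polarParts (integralAdeleAlgebra h) x)] :
    Module.finrank k⟮x⟯ F ≤ Module.finrank k (polarParts (integralAdeleAlgebra h) x) := by
  have hx0 : x ≠ 0 := ne_zero_of_transcendental hx
  set δ := Module.finrank k (polarParts (integralAdeleAlgebra h) x)
  have hupper (n : ℕ) : Module.finrank k (poleBound (k := k) x n) ≤ 1 + n * δ := by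
    induction n with
    | zero => simpa using finrank_poleBound_zero_le x
    | succ n ih =>
      have := finiteDimensional_poleBound hx n
      refine (finrank_poleBound_succ_le h hx0 n).trans ?_
      rw [add_mul, one_mul, ← add_assoc]
      exact Nat.add_le_add_right ih δ
  obtain ⟨n, hn⟩ := mul_finrank_le_finrank_poleBound hx
  by_contra! hlt
  have hN := (hn (n * δ + 2)).trans (hupper _)
  have := (Nat.mul_le_mul_left (n * δ + 2) hlt).trans hN
  nlinarith

end DegreeBound

/-- a geometrically integral smooth projective curve of genus `g > 1` over a
field `k` (given here by its function field `F`) has `k`-gonality at most `2g - 2`. -/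
theorem gonality_le_two_mul_genus_sub_two
    (k F : Type*) [Field k] [Field F] [Algebra k F]
    (hF : IsFunctionField k F)
    [IsDomain (TensorProduct k (AlgebraicClosure k) F)]
    (hg : 1 < genus k F) :
    gonality k F ≤ 2 * genus k F - 2 := by
  have h := finite_poles hF (zero_lt_one.trans hg)
  have hg' := hg
  rw [genus_eq_finrank h] at hg' ⊢
  have ⟨x, hx, hfin⟩ := hF
  have hL (n : ℕ) : ∃ x : F, FiniteDimensional k (boundedBy (integralAdeleAlgebra h) x) ∧
      n < Module.finrank k (boundedBy (integralAdeleAlgebra h) x) := by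
    refine ⟨x ^ n, ?_⟩
    rw [boundedBy_eq_poleBound h (ne_zero_of_transcendental hx) n]
    have := finiteDimensional_poleBound hx n
    exact ⟨this, lt_finrank_poleBound hx n⟩
  obtain ⟨f, hf, hffin, hfle⟩ := exists_finrank_polarParts_le (integralAdeleAlgebra h) hg' hL
  have hft := transcendental_of_notMem_range hf
  have := hF.finiteDimensional hft
  calc gonality k F ≤ Module.finrank k⟮f⟯ F := Nat.sInf_le ⟨f, hft, rfl⟩
    _ ≤ _ := finrank_adjoin_le_finrank_polarParts h hft
    _ ≤ _ := hfle
end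

section
/- Let π : X ⇢ Y be a dominant rational map of geometrically integral curves over a field k. Then γ_k(Y) ≤ γ_k(X). -/
open IntermediateField

open Polynomial

section Gauss

variable {Ω Γ : Type*} [Field Ω] [LinearOrderedCommGroupWithZero Γ] (v : Valuation Ω Γ)

/-- The coefficients of `∏ (X - α)` are bounded by `∏ max 1 (v α)`. -/
theorem Valuation.coeff_prod_X_sub_C_le (s : Multiset Ω) (j : ℕ) :
    v ((s.map fun α ↦ X - C α).prod.coeff j) ≤ (s.map fun α ↦ max 1 (v α)).prod := by
  induction s using Multiset.induction generalizing j with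
  | empty =>
    simp only [Multiset.map_zero, Multiset.prod_zero, coeff_one]
    split_ifs <;> simp
  | cons a s ih =>
    simp only [Multiset.map_cons, Multiset.prod_cons]
    have h2 : ∀ i, v a * v ((s.map fun α ↦ X - C α).prod.coeff i) ≤
        max 1 (v a) * (s.map fun α ↦ max 1 (v α)).prod := fun i ↦
      mul_le_mul' (le_max_right _ _) (ih i)
    have h1 : ∀ i, v ((s.map fun α ↦ X - C α).prod.coeff i) ≤
        max 1 (v a) * (s.map fun α ↦ max 1 (v α)).prod := fun i ↦ by
      simpa using mul_le_mul' (le_max_left 1 (v a)) (ih i)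
    cases j with
    | zero => simpa [sub_mul, Valuation.map_neg] using h2 0
    | succ j =>
      simp only [sub_mul, coeff_sub, coeff_X_mul, coeff_C_mul]
      exact v.map_sub_le (h1 j) (by simpa using h2 (j + 1))

/-- Some coefficient of `∏ (X - α)` attains the bound `∏ max 1 (v α)`. -/
theorem Valuation.exists_coeff_prod_X_sub_C_eq (s : Multiset Ω) :
    ∃ j, v ((s.map fun α ↦ X - C α).prod.coeff j) = (s.map fun α ↦ max 1 (v α)).prod := by
  classical
  induction s using Multiset.induction with
  | empty => exact ⟨0, by simp⟩
  | cons a s ih =>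
    simp only [Multiset.map_cons, Multiset.prod_cons]
    have hle := v.coeff_prod_X_sub_C_le s
    set p := (s.map fun α ↦ X - C α).prod
    set N := (s.map fun α ↦ max 1 (v α)).prod
    have hN : 0 < N := by
      obtain ⟨j, hj⟩ := ih
      refine zero_lt_iff.mpr (Multiset.prod_ne_zero fun h ↦ ?_)
      obtain ⟨x, -, hx⟩ := Multiset.mem_map.mp h
      exact (lt_of_lt_of_le zero_lt_one (le_max_left 1 (v x))).ne' hx
    rcases le_or_gt (v a) 1 with ha | ha
    · rw [max_eq_left ha, one_mul]
      have hb : ∀ j, v (p.coeff j) = N → j ≤ p.natDegree := fun j hj ↦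
        le_natDegree_of_ne_zero fun h ↦ by simp [h] at hj; exact hN.ne hj
      obtain ⟨i, hi⟩ := ih
      have hspec := Nat.findGreatest_spec (P := fun j ↦ v (p.coeff j) = N) (hb i hi) hi
      set m := Nat.findGreatest (fun j ↦ v (p.coeff j) = N) p.natDegree with hm
      refine ⟨m + 1, ?_⟩
      have hlt : v (p.coeff (m + 1)) < N := (hle _).lt_of_ne fun h ↦ by
        have := Nat.le_findGreatest (P := fun j ↦ v (p.coeff j) = N) (hb _ h) h
        omega
      simp only [sub_mul, coeff_sub, coeff_X_mul, coeff_C_mul]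
      rw [v.map_sub_eq_of_lt_left, hspec]
      rw [hspec, map_mul]
      exact lt_of_le_of_lt (mul_le_of_le_one_left' ha) hlt
    · rw [max_eq_right ha.le]
      have hspec := Nat.find_spec ih
      have hmin := fun i h ↦ Nat.find_min ih (m := i) h
      set m := Nat.find ih
      refine ⟨m, ?_⟩
      rcases hm : m with _ | i
      · rw [hm] at hspec
        simp [sub_mul, hspec]
      · simp only [sub_mul, coeff_sub, coeff_X_mul, coeff_C_mul]
        rw [← hm, v.map_sub_eq_of_lt_right, map_mul, hspec]
        rw [map_mul, hspec]
        refine (hle i).trans_lt ?_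
        exact lt_mul_of_one_lt_left hN ha

end Gauss

theorem prod_algEquiv_eq_of_mem_aroots {K L M : Type*} [Field K] [Field L] [Algebra K L]
    [FiniteDimensional K L] [Normal K L] [CommMonoid M] (φ : L → M) {x y : L}
    (hy : y ∈ (minpoly K x).aroots L) :
    ∏ g : L ≃ₐ[K] L, φ (g y) = ∏ g : L ≃ₐ[K] L, φ (g x) := by
  obtain ⟨σ, rfl⟩ := isConjRoot_iff_exists_algEquiv.mp
    ((isConjRoot_iff_mem_minpoly_aroots (Algebra.IsIntegral.isIntegral x)).mpr hy)
  symm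
  exact Fintype.prod_equiv (Equiv.mulRight σ) _ _ (by simp)

/-- The product of `φ` over the Galois orbit of `x` and its product over the conjugate roots of
`x` agree up to the appropriate powers. -/
theorem prod_prod_algEquiv_pow {K L M : Type*} [Field K] [Field L] [Algebra K L]
    [FiniteDimensional K L] [Normal K L] [CommMonoid M] (φ : L → M) (x : L) :
    (∏ g : L ≃ₐ[K] L, φ (g x)) ^ (minpoly K x).natDegree =
      (((minpoly K x).aroots L).map φ).prod ^ Fintype.card (L ≃ₐ[K] L) := by
  have h2 : ∀ g : L ≃ₐ[K] L, (((minpoly K x).aroots L).map fun y ↦ φ (g y)).prod =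
      (((minpoly K x).aroots L).map φ).prod := by
    intro g
    have : ((minpoly K x).aroots L).map g = (minpoly K x).aroots L := by
      have := Polynomial.roots_map_of_injective_of_card_eq_natDegree
        (p := (minpoly K x).map (algebraMap K L)) (f := (g : L →+* L)) g.injective ?_
      · rw [Polynomial.map_map] at this
        have hg : (g : L →+* L).comp (algebraMap K L) = algebraMap K L := by ext; simp
        rw [hg] at this
        simpa [aroots_def] using this
      · exact (Normal.splits ‹_› x).natDegree_eq_card_roots.symm
    conv_rhs => rw [← this, Multiset.map_map]
    rfl
  have h3 : (((minpoly K x).aroots L).map fun y ↦ ∏ g : L ≃ₐ[K] L, φ (g y)).prod =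
      (∏ g : L ≃ₐ[K] L, φ (g x)) ^ (minpoly K x).natDegree := by
    rw [Multiset.map_congr rfl fun y hy ↦ prod_algEquiv_eq_of_mem_aroots φ hy,
      Multiset.map_const', Multiset.prod_replicate,
      ← (Normal.splits ‹_› x).natDegree_eq_card_roots, natDegree_map]
  rw [← h3, Multiset.prod_map_prod, Finset.prod_congr rfl fun g _ ↦ h2 g]
  simp

open IntermediateField.algebraAdjoinAdjoin in
/-- In the function field of a curve, every transcendental element generates a subfield of
finite index. -/
theorem Transcendental.finiteDimensional_adjoin {k F : Type*} [Field k] [Field F] [Algebra k F]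
    {x f : F} [FiniteDimensional k⟮x⟯ F] (hf : Transcendental k f) :
    FiniteDimensional k⟮f⟯ F := by
  have : Algebra.EssFiniteType k k⟮x⟯ :=
    IntermediateField.essFiniteType_iff.mpr
      (IntermediateField.fg_adjoin_of_finite (Set.finite_singleton x))
  have hess : Algebra.EssFiniteType k F := .comp k k⟮x⟯ F
  have : Algebra.IsAlgebraic (Algebra.adjoin k {x}) F :=
    (IsFractionRing.comap_isAlgebraic_iff (K := k⟮x⟯)).mpr inferInstance
  have htr := Algebra.IsAlgebraic.trdeg_le_cardinalMk k ({x} : Set F)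
  have hb := AlgebraicIndependent.isTranscendenceBasis_of_trdeg_le_of_finite
    (x := fun _ : ({x} : Set F) ↦ f)
    ((algebraicIndependent_unique_type_iff).mpr hf) htr
  have := hb.isAlgebraic
  rw [Set.range_const] at this
  have : Algebra.IsAlgebraic k⟮f⟯ F :=
    (IsFractionRing.comap_isAlgebraic_iff (A := Algebra.adjoin k {f})).mp this
  have : Algebra.EssFiniteType k⟮f⟯ F := .of_comp k k⟮f⟯ F
  exact Algebra.finite_of_essFiniteType_of_isAlgebraic

/-- A transcendental element is a pole of some valuation trivial on the base field. -/
theorem exists_valuation_gt_one_of_transcendental {k Ω : Type*} [Field k] [Field Ω]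
    [Algebra k Ω] {c : Ω}
    (hc : Transcendental k c) : ∃ V : ValuationSubring Ω,
      (∀ a : k, V.valuation (algebraMap k Ω a) ≤ 1) ∧ 1 < V.valuation c := by
  have hc' : c ∉ (integralClosure k Ω).toSubring := fun h ↦ hc (IsIntegral.isAlgebraic h)
  obtain ⟨V, hV, hcV⟩ := Subring.exists_le_valuationSubring_of_isIntegrallyClosedIn hc'
  refine ⟨V, fun a ↦ (V.valuation_le_one_iff _).mpr
    (hV (algebraMap_mem (integralClosure k Ω) a)), ?_⟩
  rwa [← not_le, V.valuation_le_one_iff]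

theorem valuation_aeval_le {k Ω Γ : Type*} [Field k] [Field Ω] [Algebra k Ω]
    [LinearOrderedCommGroupWithZero Γ] (v : Valuation Ω Γ)
    (hv : ∀ a : k, v (algebraMap k Ω a) ≤ 1) {c : Ω} (hc : 1 < v c) (p : k[X]) :
    v (aeval c p) ≤ v c ^ p.natDegree := by
  rw [aeval_eq_sum_range]
  refine v.map_sum_le fun i hi ↦ ?_
  rw [Algebra.smul_def, map_mul, map_pow]
  exact (mul_le_of_le_one_left' (hv _)).trans
    (pow_le_pow_right₀ hc.le (by simpa [Nat.lt_succ_iff] using hi))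

theorem one_le_valuation_aeval {k Ω Γ : Type*} [Field k] [Field Ω] [Algebra k Ω]
    [LinearOrderedCommGroupWithZero Γ] (v : Valuation Ω Γ)
    (hv : ∀ a : k, v (algebraMap k Ω a) ≤ 1) {c : Ω} (hc : 1 < v c) {p : k[X]} (hp : p ≠ 0) :
    1 ≤ v (aeval c p) := by
  have hv1 : ∀ a : k, a ≠ 0 → v (algebraMap k Ω a) = 1 := by
    intro a ha
    refine (hv a).antisymm ?_
    have := hv a⁻¹
    rw [map_inv₀, map_inv₀] at this
    exact (inv_le_one₀ (by simpa [zero_lt_iff] using ha)).mp this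
  rw [aeval_eq_sum_range, Finset.sum_range_succ, v.map_add_eq_of_lt_right]
  · rw [Algebra.smul_def, map_mul, hv1 _ (by simpa using hp), one_mul, map_pow]
    exact one_le_pow₀ hc.le
  · rw [Algebra.smul_def, map_mul, hv1 _ (by simpa using hp), one_mul, map_pow]
    refine v.map_sum_lt' (pow_pos (zero_lt_one.trans hc) _) fun i hi ↦ ?_
    rw [Algebra.smul_def, map_mul, map_pow]
    exact (mul_le_of_le_one_left' (hv _)).trans_lt (pow_lt_pow_right₀ hc (by simpa using hi))

open IntermediateField.algebraAdjoinAdjoin in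
/-- A polynomial relation between `c` and `f` whose degree in `c` is the degree of `c` over
`k(f)`. -/
theorem exists_aeval_eq_zero_coeff_eq_aeval {k K F : Type*} [Field k] [Field K] [Field F]
    [Algebra k K] [Algebra k F] [Algebra K F] [IsScalarTower k K F] {c : K}
    (hc : Transcendental k c) (f : F) (hcf : IsIntegral k⟮f⟯ (algebraMap K F c)) :
    ∃ S : K[X], S ≠ 0 ∧ aeval f S = 0 ∧ ∀ j, ∃ h : k[X],
      h.natDegree ≤ (minpoly k⟮f⟯ (algebraMap K F c)).natDegree ∧ S.coeff j = aeval c h := by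
  set q := minpoly k⟮f⟯ (algebraMap K F c) with hq
  obtain ⟨b, hb⟩ := IsLocalization.exist_integer_multiples (nonZeroDivisors (Algebra.adjoin k {f}))
    (Finset.range (q.natDegree + 1)) q.coeff
  have hb0 : ((b : Algebra.adjoin k {f}) : F) ≠ 0 := by
    simp
  have hp : ∀ i, ∃ p : k[X], i ∈ Finset.range (q.natDegree + 1) →
      aeval f p = (b : Algebra.adjoin k {f}) * (q.coeff i : F) := by
    intro i
    by_cases hi : i ∈ Finset.range (q.natDegree + 1)
    · obtain ⟨⟨y, hy⟩, hy'⟩ := hb i hi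
      rw [Algebra.adjoin_singleton_eq_range_aeval] at hy
      obtain ⟨p, hp⟩ := hy
      refine ⟨p, fun _ ↦ ?_⟩
      have := congrArg (algebraMap k⟮f⟯ F) hy'
      simp only [Algebra.smul_def, map_mul] at this
      exact hp.trans this
    · exact ⟨0, fun h ↦ absurd h hi⟩
  choose p hp using hp
  have hcoeff : ∀ j, (∑ i ∈ Finset.range (q.natDegree + 1),
        C (c ^ i) * (p i).map (algebraMap k K)).coeff j =
      aeval c (∑ i ∈ Finset.range (q.natDegree + 1), C ((p i).coeff j) * X ^ i) := by
    intro j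
    rw [finsetSum_coeff, map_sum]
    refine Finset.sum_congr rfl fun i _ ↦ ?_
    rw [coeff_C_mul, coeff_map, map_mul, aeval_C, map_pow, aeval_X, mul_comm]
  refine ⟨∑ i ∈ Finset.range (q.natDegree + 1), C (c ^ i) * (p i).map (algebraMap k K),
    ?_, ?_, ?_⟩
  · intro h0
    have hpa : p q.natDegree ≠ 0 := fun h ↦ by
      have := hp q.natDegree (by simp)
      rw [h, (minpoly.monic hcf).coeff_natDegree] at this
      simp at this
      exact hb0 this.symm
    obtain ⟨j, hj⟩ : ∃ j, (p q.natDegree).coeff j ≠ 0 := by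
      by_contra! h
      exact hpa (Polynomial.ext (by simpa using h))
    have := hcoeff j
    rw [h0, coeff_zero] at this
    have := (transcendental_iff.mp hc) _ this.symm
    have := congrArg (coeff · q.natDegree) this
    simp [coeff_X_pow] at this
    exact hj this
  · have h1 : ∀ i ∈ Finset.range (q.natDegree + 1),
        aeval f (C (c ^ i) * (p i).map (algebraMap k K)) =
        (b : Algebra.adjoin k {f}) * ((q.coeff i : F) * (algebraMap K F c) ^ i) := by
      intro i hi
      rw [map_mul, aeval_map_algebraMap, hp i hi]
      simp
      ring
    rw [map_sum, Finset.sum_congr rfl h1, ← Finset.mul_sum]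
    have h2 := minpoly.aeval k⟮f⟯ (algebraMap K F c)
    rw [aeval_eq_sum_range] at h2
    simp only [Algebra.smul_def] at h2
    exact mul_eq_zero_of_right _ h2
  · intro j
    refine ⟨_, ?_, hcoeff j⟩
    refine natDegree_sum_le_of_forall_le _ _ fun i hi ↦ ?_
    exact (natDegree_C_mul_X_pow_le _ _).trans (by simpa [Nat.lt_succ_iff] using hi)

theorem prod_max_one_aroots_le {k K Ω Γ : Type*} [Field k] [Field K] [Field Ω] [Algebra k K]
    [Algebra k Ω] [Algebra K Ω] [IsScalarTower k K Ω] [IsAlgClosed Ω]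
    [LinearOrderedCommGroupWithZero Γ] (v : Valuation Ω Γ)
    (hv : ∀ a : k, v (algebraMap k Ω a) ≤ 1) {c : K} (hc : 1 < v (algebraMap K Ω c))
    {S : K[X]} (hS : S ≠ 0) {a : ℕ}
    (hSa : ∀ j, ∃ h : k[X], h.natDegree ≤ a ∧ S.coeff j = aeval c h) {R : K[X]} (hR : R ∣ S) :
    ((R.aroots Ω).map fun α ↦ max 1 (v α)).prod ≤ v (algebraMap K Ω c) ^ a := by
  have hle : R.aroots Ω ≤ S.aroots Ω :=
    roots.le_of_dvd (by simpa using hS) (Polynomial.map_dvd _ hR)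
  obtain ⟨j, hj⟩ := v.exists_coeff_prod_X_sub_C_eq (S.aroots Ω)
  obtain ⟨h, ha, hh⟩ := hSa j
  obtain ⟨h', -, hh'⟩ := hSa S.natDegree
  have h1 : 1 ≤ v (algebraMap K Ω S.leadingCoeff) := by
    rw [leadingCoeff, hh', ← aeval_algebraMap_apply]
    refine one_le_valuation_aeval v hv hc ?_
    rintro rfl
    simp [hS] at hh'
  have h2 : v (algebraMap K Ω (S.coeff j)) ≤ v (algebraMap K Ω c) ^ a := by
    rw [hh, ← aeval_algebraMap_apply]
    exact (valuation_aeval_le v hv hc h).trans (pow_le_pow_right₀ hc.le ha)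
  have h3 := congrArg (coeff · j) (IsAlgClosed.splits (S.map (algebraMap K Ω))).eq_prod_roots
  simp only [coeff_map, coeff_C_mul, leadingCoeff_map] at h3
  calc _ ≤ ((S.aroots Ω).map fun α ↦ max 1 (v α)).prod := by
        obtain ⟨t, ht⟩ := Multiset.le_iff_exists_add.mp hle
        rw [ht, Multiset.map_add, Multiset.prod_add]
        refine le_mul_of_one_le_right' ?_
        refine Multiset.one_le_prod fun y hy ↦ ?_
        obtain ⟨α, -, rfl⟩ := Multiset.mem_map.mp hy
        exact le_max_left _ _
    _ ≤ v (algebraMap K Ω (S.coeff j)) := by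
        rw [← hj, h3, map_mul]
        exact le_mul_of_one_le_left' h1
    _ ≤ _ := h2

/-- If `c ∈ K` is a coefficient of the minimal polynomial of `f` over `E`, and `f` satisfies a
relation over `k[c]` of degree at most `a` in `c`, then `[K(f) : K] ≤ a [E(f) : E]`. -/
theorem natDegree_minpoly_le_mul {k K E F : Type*} [Field k] [Field K] [Field E] [Field F]
    [Algebra k K] [Algebra K E] [Algebra E F] [Algebra K F] [IsScalarTower K E F] [FiniteDimensional K F]
    {c : K} (hc : Transcendental k c) {f : F} {i : ℕ} (hi : (minpoly E f).coeff i = algebraMap K E c)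
    {S : K[X]} (hS : S ≠ 0) (hSf : aeval f S = 0)
    {a : ℕ} (hSa : ∀ j, ∃ h : k[X], h.natDegree ≤ a ∧ S.coeff j = aeval c h) :
    (minpoly K f).natDegree ≤ a * (minpoly E f).natDegree := by
  let L := normalClosure K F (AlgebraicClosure F)
  let Ω := AlgebraicClosure L
  let : Algebra E L := ((algebraMap F L).comp (algebraMap E F)).toAlgebra
  have : IsScalarTower E F L := .of_algebraMap_eq' rfl
  have : IsScalarTower K E L := .of_algebraMap_eq' (by
    rw [IsScalarTower.algebraMap_eq E F L, RingHom.comp_assoc, ← IsScalarTower.algebraMap_eq K E F,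
      ← IsScalarTower.algebraMap_eq K F L])
  let : Algebra k Ω := ((algebraMap K Ω).comp (algebraMap k K)).toAlgebra
  have : IsScalarTower k K Ω := .of_algebraMap_eq' rfl
  obtain ⟨V, hV, hVc⟩ := exists_valuation_gt_one_of_transcendental (k := k) (c := algebraMap K Ω c)
    ((transcendental_algebraMap_iff (algebraMap K Ω).injective).mpr hc)
  set v := V.valuation
  let φ : L → V.ValueGroup := fun y ↦ max 1 (v (algebraMap L Ω y))
  set w := v (algebraMap K Ω c)
  set x := algebraMap F L f
  set G := L ≃ₐ[K] L
  have hxK : minpoly K x = minpoly K f := minpoly.algebraMap_eq (algebraMap F L).injective f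
  have hxE : minpoly E x = minpoly E f := minpoly.algebraMap_eq (algebraMap F L).injective f
  have hKL : ((minpoly K x).map (algebraMap K L)).Splits := Normal.splits inferInstance x
  have hdvd : (minpoly E x).map (algebraMap E L) ∣ (minpoly K x).map (algebraMap K L) := by
    rw [IsScalarTower.algebraMap_eq K E L, ← Polynomial.map_map]
    exact Polynomial.map_dvd _ (minpoly.dvd_map_of_isScalarTower K E x)
  have hne : (minpoly K x).map (algebraMap K L) ≠ 0 :=
    Polynomial.map_ne_zero (minpoly.ne_zero (Algebra.IsIntegral.isIntegral x))
  have hEL : ((minpoly E x).map (algebraMap E L)).Splits := hKL.of_dvd hne hdvd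
  have hEint : IsIntegral E x := (Algebra.IsIntegral.isIntegral (R := K) x).tower_top
  set s := (minpoly E x).aroots L
  have hprod : (minpoly E x).map (algebraMap E L) = (s.map fun α ↦ X - C α).prod :=
    hEL.eq_prod_roots_of_monic ((minpoly.monic hEint).map _)
  have hcard : s.card = (minpoly E f).natDegree := by
    rw [← hxE, ← natDegree_map (algebraMap E L), hEL.natDegree_eq_card_roots]
  have hg : ∀ g : G, w ≤ (s.map fun y ↦ φ (g y)).prod := by
    intro g
    have h1 := v.coeff_prod_X_sub_C_le (s.map fun y ↦ algebraMap L Ω (g y)) i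
    have h2 : ((s.map fun y ↦ algebraMap L Ω (g y)).map fun α ↦ X - C α).prod =
        (((minpoly E x).map (algebraMap E L)).map (g : L →+* L)).map (algebraMap L Ω) := by
      rw [hprod, Polynomial.map_multiset_prod, Polynomial.map_multiset_prod]
      simp [Multiset.map_map]
    have h3 : algebraMap L Ω (g (algebraMap E L (algebraMap K E c))) = algebraMap K Ω c := by
      rw [← IsScalarTower.algebraMap_apply K E L, AlgEquiv.commutes,
        ← IsScalarTower.algebraMap_apply K L Ω]
    rw [h2, coeff_map, coeff_map, coeff_map, hxE, hi, RingHom.coe_coe, h3, Multiset.map_map] at h1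
    exact h1
  have hΦ : w ^ Fintype.card G ≤ (∏ g : G, φ (g x)) ^ (minpoly E f).natDegree := by
    calc w ^ Fintype.card G = ∏ g : G, w := by simp
      _ ≤ ∏ g : G, (s.map fun y ↦ φ (g y)).prod := Finset.prod_le_prod' fun g _ ↦ hg g
      _ = (s.map fun y ↦ ∏ g : G, φ (g y)).prod := by rw [Multiset.prod_map_prod]
      _ = _ := by
        rw [Multiset.map_congr rfl fun y hy ↦ prod_algEquiv_eq_of_mem_aroots (K := K) φ
          (Multiset.mem_of_le (roots.le_of_dvd hne hdvd) hy), Multiset.map_const',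
          Multiset.prod_replicate, hcard]
  have hRS : (((minpoly K x).aroots L).map φ).prod ≤ w ^ a := by
    have := prod_max_one_aroots_le v hV hVc hS hSa (R := minpoly K x) (by
      rw [hxK]; exact minpoly.dvd K f hSf)
    rwa [aroots_def, IsScalarTower.algebraMap_eq K L Ω, ← Polynomial.map_map,
      hKL.roots_map, Multiset.map_map] at this
  have key := prod_prod_algEquiv_pow (K := K) φ x
  rw [hxK] at key hRS
  have hfin : w ^ (Fintype.card G * (minpoly K f).natDegree) ≤
      w ^ (Fintype.card G * (a * (minpoly E f).natDegree)) := by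
    calc _ = (w ^ Fintype.card G) ^ (minpoly K f).natDegree := pow_mul _ _ _
      _ ≤ ((∏ g : G, φ (g x)) ^ (minpoly E f).natDegree) ^ (minpoly K f).natDegree :=
        pow_le_pow_left' hΦ _
      _ = ((∏ g : G, φ (g x)) ^ (minpoly K f).natDegree) ^ (minpoly E f).natDegree :=
        pow_right_comm _ _ _
      _ ≤ ((w ^ a) ^ Fintype.card G) ^ (minpoly E f).natDegree := by
        rw [key]
        exact pow_le_pow_left' (pow_le_pow_left' hRS _) _
      _ = _ := by rw [← pow_mul, ← pow_mul]; congr 1; ring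
  exact Nat.le_of_mul_le_mul_left ((pow_le_pow_iff_right₀ hVc).mp hfin) Fintype.card_pos

theorem exists_transcendental_coeff_minpoly {k E F : Type*} [Field k] [Field E] [Field F]
    [Algebra k E] [Algebra k F] [Algebra E F] [IsScalarTower k E F] {f : F}
    (hf : Transcendental k f) (hfE : IsIntegral E f) :
    ∃ i, Transcendental k ((minpoly E f).coeff i) := by
  by_contra! h
  simp only [Transcendental, not_not] at h
  have h1 : minpoly E f ∈ lifts (algebraMap (algebraicClosure k E) E) := by
    rw [lifts_iff_coeff_lifts]
    intro n
    exact ⟨⟨(minpoly E f).coeff n, (mem_algebraicClosure_iff).mpr (h n)⟩, rfl⟩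
  obtain ⟨q, hq⟩ := h1
  refine hf ?_
  have : IsAlgebraic (algebraicClosure k E) f := by
    refine ⟨q, ?_, ?_⟩
    · rintro rfl
      exact minpoly.ne_zero hfE (by simpa using hq.symm)
    · rw [← aeval_map_algebraMap E]
      exact (congrArg (aeval f) hq).trans (minpoly.aeval E f)
  exact this.restrictScalars k

theorem finrank_adjoin_le {k K F : Type*} [Field k] [Field K] [Field F] [Algebra k K] [Algebra k F]
    [Algebra K F] [IsScalarTower k K F] (f : F) (c : K) [FiniteDimensional k⟮f⟯ F] :
    Module.finrank K⟮f⟯ F ≤ Module.finrank k⟮f⟯⟮algebraMap K F c⟯ F := by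
  have hle : k⟮f⟯⟮algebraMap K F c⟯.restrictScalars k ≤ K⟮f⟯.restrictScalars k := by
    rw [adjoin_simple_adjoin_simple, adjoin_le_iff, Set.insert_subset_iff,
      Set.singleton_subset_iff]
    exact ⟨mem_adjoin_simple_self K f, IntermediateField.algebraMap_mem K⟮f⟯ c⟩
  have : FiniteDimensional k⟮f⟯⟮algebraMap K F c⟯ F := .right k⟮f⟯ _ F
  have : FiniteDimensional (k⟮f⟯⟮algebraMap K F c⟯.restrictScalars k) F := this
  exact IntermediateField.finrank_le_of_le_left hle

/-- If `c` is a coefficient of the minimal polynomial of `f` over `E`, then the degree of `c` as a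
function in `E` is at most the degree of `f` as a function in `F`. -/
theorem finrank_le_finrank_adjoin {k K E F : Type*} [Field k] [Field K] [Field E] [Field F]
    [Algebra k K] [Algebra k F] [Algebra K E] [Algebra E F] [Algebra K F] [IsScalarTower k K F]
    [IsScalarTower K E F] [FiniteDimensional K F] {c : K} (hc : Transcendental k c) {f : F}
    [FiniteDimensional k⟮f⟯ F] {i : ℕ} (hi : (minpoly E f).coeff i = algebraMap K E c) :
    Module.finrank K E ≤ Module.finrank k⟮f⟯ F := by
  have : FiniteDimensional E F := .right K E F
  have hcf : IsIntegral k⟮f⟯ (algebraMap K F c) := Algebra.IsIntegral.isIntegral _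
  obtain ⟨S, hS, hSf, hSa⟩ := exists_aeval_eq_zero_coeff_eq_aeval hc f hcf
  have hb := natDegree_minpoly_le_mul hc hi hS hSf hSa
  rw [← IntermediateField.adjoin.finrank (Algebra.IsIntegral.isIntegral (R := K) f),
    ← IntermediateField.adjoin.finrank (Algebra.IsIntegral.isIntegral (R := E) f),
    ← IntermediateField.adjoin.finrank hcf] at hb
  have p1 : 0 < Module.finrank E⟮f⟯ F := Module.finrank_pos
  have p2 : 0 < Module.finrank E E⟮f⟯ := Module.finrank_pos
  refine Nat.le_of_mul_le_mul_right ?_ p2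
  calc Module.finrank K E * Module.finrank E E⟮f⟯
      ≤ Module.finrank K E * (Module.finrank E E⟮f⟯ * Module.finrank E⟮f⟯ F) :=
        Nat.mul_le_mul_left _ (Nat.le_mul_of_pos_right _ p1)
    _ = Module.finrank K K⟮f⟯ * Module.finrank K⟮f⟯ F := by
        rw [Module.finrank_mul_finrank, Module.finrank_mul_finrank, Module.finrank_mul_finrank]
    _ ≤ _ := Nat.mul_le_mul hb (finrank_adjoin_le f c)
    _ = _ := by
        rw [← Module.finrank_mul_finrank k⟮f⟯ k⟮f⟯⟮algebraMap K F c⟯ F]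
        ring

theorem finiteDimensional_adjoin_of_algebraMap {k E F : Type*} [Field k] [Field E] [Field F]
    [Algebra k E] [Algebra k F] [Algebra E F] [IsScalarTower k E F] (c : E)
    [h : FiniteDimensional k⟮algebraMap E F c⟯ F] : FiniteDimensional k⟮c⟯ F := by
  have hmap : k⟮c⟯.map (IsScalarTower.toAlgHom k E F) = k⟮algebraMap E F c⟯ := by
    rw [adjoin_map, Set.image_singleton]
    rfl
  rw [← hmap] at h
  let e := (k⟮c⟯.equivMap (IsScalarTower.toAlgHom k E F)).symm
  let _ := e.toRingHom.toAlgebra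
  have : IsScalarTower (k⟮c⟯.map (IsScalarTower.toAlgHom k E F)) k⟮c⟯ F :=
    .of_algebraMap_eq fun r ↦ (congrArg Subtype.val (e.symm_apply_apply r)).symm
  exact .right (k⟮c⟯.map (IsScalarTower.toAlgHom k E F)) k⟮c⟯ F

/-- if `π : X ⇢ Y` is a dominant rational map of geometrically integral curves
over `k`, then `γ_k(Y) ≤ γ_k(X)`.  The curves are given by their function fields
`F = k(X)` and `E = k(Y)`; the dominant rational map `π` corresponds to a `k`-embedding
`ι : E →ₐ[k] F` of function fields. -/
theorem gonality_of_dominated_le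
    (k E F : Type*) [Field k] [Field E] [Field F] [Algebra k E] [Algebra k F]
    (hE : IsFunctionField k E) (hF : IsFunctionField k F)
    [IsDomain (TensorProduct k (AlgebraicClosure k) E)]
    [IsDomain (TensorProduct k (AlgebraicClosure k) F)]
    (ι : E →ₐ[k] F) :
    gonality k E ≤ gonality k F := by
  obtain ⟨x, hx, -⟩ := hE
  obtain ⟨y, hy, hyF⟩ := hF
  obtain ⟨f, hf, hd⟩ := Nat.sInf_mem (s := {d : ℕ | ∃ f : F, Transcendental k f ∧
    Module.finrank (IntermediateField.adjoin k {f}) F = d}) ⟨_, y, hy, rfl⟩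
  change _ = gonality k F at hd
  rw [← hd]
  let _ : Algebra E F := ι.toRingHom.toAlgebra
  have : IsScalarTower k E F := .of_algebraMap_eq fun r ↦ (ι.commutes r).symm
  have hfin : ∀ c : E, Transcendental k c → FiniteDimensional k⟮c⟯ F := fun c hc ↦
    have : FiniteDimensional k⟮algebraMap E F c⟯ F :=
      ((transcendental_algebraMap_iff (algebraMap E F).injective).mpr hc).finiteDimensional_adjoin
        (x := y)
    finiteDimensional_adjoin_of_algebraMap c
  have : FiniteDimensional E F :=
    have := hfin x hx
    .right k⟮x⟯ E F
  obtain ⟨i, hi⟩ :=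
    exists_transcendental_coeff_minpoly (E := E) hf (Algebra.IsIntegral.isIntegral f)
  have := hfin _ hi
  have : FiniteDimensional k⟮f⟯ F := hf.finiteDimensional_adjoin (x := y)
  refine le_trans (Nat.sInf_le ⟨_, hi, rfl⟩) ?_
  exact finrank_le_finrank_adjoin (c := AdjoinSimple.gen k ((minpoly E f).coeff i))
    ((transcendental_algebraMap_iff
      (algebraMap k⟮(minpoly E f).coeff i⟯ E).injective).mp hi) (i := i) rfl
end
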